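/- arXiv:2402.09003 — 3 statements merged into one kernel-verified Lean document; each statement's English description precedes it below -/
import Mathlib

section
/- Let P₁, P₂ be independent random points uniformly distributed in the ball of radius R > 0 in ℝ^d (d ≥ 2) centered at the origin. Then the random variable Z = ‖P₁ − P₂‖ has probability density ψ(z) = (d/R^d) z^{d-1} I_{1-(z/(2R))²}((d+1)/2, 1/2) for 0 ≤ z ≤ 2R, where I_μ(p,q) is the regularized incomplete beta function. -/
open Real MeasureTheory Metric

/-- Regularized incomplete beta function `I_μ(p,q)`. -/
noncomputable def regIncBeta (μ p q : ℝ) : ℝ :=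
  (Real.Gamma (p + q) / (Real.Gamma p * Real.Gamma q)) *
    ∫ t in (0:ℝ)..μ, t ^ (p - 1) * (1 - t) ^ (q - 1)

open scoped ENNReal

lemma aux_polar {E : Type*} [NormedAddCommGroup E] [NormedSpace ℝ E] [FiniteDimensional ℝ E]
    [Nontrivial E]
    [MeasurableSpace E] [BorelSpace E] (μ : Measure E) [μ.IsAddHaarMeasure] (f : ℝ → ℝ≥0∞)
    (hf : Measurable f) :
    ∫⁻ x, f ‖x‖ ∂μ = (Module.finrank ℝ E) * μ (ball 0 1) *
      ∫⁻ y in Set.Ioi (0:ℝ), ENNReal.ofReal (y ^ (Module.finrank ℝ E - 1)) * f y := by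
  calc
    ∫⁻ x, f (‖x‖) ∂μ = ∫⁻ x : ({(0)}ᶜ : Set E), f (‖x.1‖) ∂(μ.comap (↑)) := by
      rw [lintegral_subtype_comap (measurableSet_singleton _).compl fun x ↦ f (‖x‖),
        restrict_compl_singleton]
    _ = ∫⁻ x, f x.2 ∂μ.toSphere.prod (.volumeIoiPow (Module.finrank ℝ E - 1)) := by
      simpa using μ.measurePreserving_homeomorphUnitSphereProd.lintegral_comp_emb
        (Homeomorph.measurableEmbedding _) (f ∘ Subtype.val ∘ Prod.snd)
    _ = μ.toSphere Set.univ * ∫⁻ x : Set.Ioi (0 : ℝ), f x ∂.volumeIoiPow (Module.finrank ℝ E - 1) := by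
      rw [lintegral_prod _ (by fun_prop)]
      simp [mul_comm]
    _ = _ := by
      rw [μ.toSphere_apply_univ, Measure.volumeIoiPow,
        lintegral_withDensity_eq_lintegral_mul _ (by fun_prop) (by fun_prop),
        ← lintegral_subtype_comap measurableSet_Ioi]
      rfl

lemma aux_subst (n : ℕ) (R a : ℝ) (ha : 0 < a) (haR : a ≤ R) :
    ∫ t in (0:ℝ)..(1 - (a / R) ^ 2), t ^ ((n : ℝ) / 2) * (1 - t) ^ (-(1/2) : ℝ)
      = 2 / R ^ (n + 1) * ∫ s in a..R, (√(R ^ 2 - s ^ 2)) ^ n := by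
  have hR : 0 < R := ha.trans_le haR
  have key := intervalIntegral.integral_comp_mul_deriv'' (a := R) (b := a)
    (f := fun s => 1 - (s / R) ^ 2) (f' := fun s => -(2 * s / R ^ 2))
    (g := fun t => t ^ ((n : ℝ) / 2) * (1 - t) ^ (-(1/2) : ℝ)) (by fun_prop) ?_ (by fun_prop) ?_
  · have h1 : (1 - (R / R) ^ 2 : ℝ) = 0 := by field_simp; simp
    simp only [h1] at key
    rw [← key, intervalIntegral.integral_symm, ← intervalIntegral.integral_const_mul,
      ← intervalIntegral.integral_neg]
    refine intervalIntegral.integral_congr fun s hs => ?_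
    rw [Set.uIcc_of_le haR] at hs
    have hs0 : 0 < s := ha.trans_le hs.1
    have h2 : (0:ℝ) ≤ 1 - (s / R) ^ 2 := by
      have : s / R ≤ 1 := (div_le_one hR).2 hs.2
      have : 0 < s / R := by positivity
      nlinarith
    have h3 : R ^ 2 - s ^ 2 = R ^ 2 * (1 - (s / R) ^ 2) := by field_simp
    have h4 : (1 - (1 - (s / R) ^ 2)) ^ (-(1/2) : ℝ) = R / s := by
      rw [sub_sub_cancel, ← Real.rpow_natCast, ← Real.rpow_mul (by positivity)]
      norm_num [Real.rpow_neg_one]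
    simp only [Function.comp]
    rw [h4, h3, Real.sqrt_mul (by positivity), Real.sqrt_sq hR.le, Real.sqrt_eq_rpow, mul_pow,
      ← Real.rpow_natCast _ n, ← Real.rpow_natCast (_ ^ (1/2:ℝ)) n, ← Real.rpow_mul h2,
      show (1 / 2 * (n:ℝ)) = (n:ℝ) / 2 by ring, Real.rpow_natCast]
    field_simp
    ring
  · intro x _
    have : HasDerivAt (fun s : ℝ => 1 - (s / R) ^ 2) (-(2 * x / R ^ 2)) x := by
      have := (((hasDerivAt_id x).div_const R).pow 2).const_sub 1
      refine this.congr_deriv ?_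
      simp only [id]
      push_cast
      field_simp
    exact this.hasDerivWithinAt
  · rintro _ ⟨s, hs, rfl⟩
    rw [Set.uIcc_of_ge haR] at hs
    have hs0 : 0 < s := ha.trans_le hs.1
    apply ContinuousAt.continuousWithinAt
    apply ContinuousAt.mul
    · exact continuousAt_id.rpow_const (Or.inr (by positivity))
    · apply ContinuousAt.rpow_const (by fun_prop)
      left
      simp only [sub_sub_cancel]; positivity

lemma aux_slice (n : ℕ) (R z : ℝ) (hz : 0 < z) (hzR : z ≤ 2 * R) (hn : 1 ≤ n) :
    ∫⁻ s : ℝ, ENNReal.ofReal ((√(R ^ 2 - (|s| + z / 2) ^ 2)) ^ n)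
      = ENNReal.ofReal (2 * ∫ s in (z / 2)..R, (√(R ^ 2 - s ^ 2)) ^ n) := by
  have hR : 0 < R := by linarith
  set h : ℝ → ℝ := fun u => (√(R ^ 2 - (u + z / 2) ^ 2)) ^ n with hh
  have hzero : ∀ u, R - z / 2 ≤ u → h u = 0 := by
    intro u hu
    simp only [hh]
    rw [Real.sqrt_eq_zero_of_nonpos (by nlinarith), zero_pow (by omega)]
  have hcont : Continuous h := by fun_prop
  have hint : Integrable (fun s => h |s|) := by
    apply Continuous.integrable_of_hasCompactSupport (by fun_prop)
    apply HasCompactSupport.of_support_subset_isCompact (isCompact_Icc (a := -R) (b := R))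
    intro s hs
    by_contra hc
    apply hs
    apply hzero
    rw [Set.mem_Icc, ← abs_le, not_le] at hc
    linarith
  rw [← ofReal_integral_eq_lintegral_ofReal hint (Filter.Eventually.of_forall fun s => by simp only [hh]; positivity),
    integral_comp_abs]
  congr 2
  have : ∫ s in Set.Ioi (0:ℝ), h s = ∫ s in Set.Ioc 0 (R - z/2), h s := by
    apply setIntegral_eq_of_subset_of_forall_sdiff_eq_zero measurableSet_Ioi
    · exact fun x hx => hx.1
    · rintro x ⟨hx, hx2⟩
      apply hzero
      by_contra hc
      exact hx2 ⟨hx, (not_le.1 hc).le⟩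
  rw [this, ← intervalIntegral.integral_of_le (by linarith)]
  have := intervalIntegral.integral_comp_add_right (a := 0) (b := R - z/2) (fun s => (√(R ^ 2 - s ^ 2)) ^ n) (z/2)
  simpa [hh] using this

lemma aux_rot {E : Type*} [NormedAddCommGroup E] [InnerProductSpace ℝ E] [FiniteDimensional ℝ E]
    [MeasurableSpace E] [BorelSpace E] (R : ℝ) (v w : E) (h : ‖v‖ = ‖w‖) :
    volume {y : E | ‖y‖ ≤ R ∧ ‖v + y‖ ≤ R} = volume {y : E | ‖y‖ ≤ R ∧ ‖w + y‖ ≤ R} := by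
  have key := Submodule.reflection_sub h
  set T := Submodule.reflection (Submodule.span ℝ {v - w})ᗮ
  have := T.measurePreserving.measure_preimage_emb T.toHomeomorph.measurableEmbedding
    {y : E | ‖y‖ ≤ R ∧ ‖w + y‖ ≤ R}
  rw [← this]
  congr 1
  ext y
  simp only [Set.mem_ofPred_eq, Set.mem_preimage, LinearIsometryEquiv.norm_map]
  rw [← key, ← map_add, LinearIsometryEquiv.norm_map]

lemma aux_euclid (n : ℕ) (hn : 1 ≤ n) (c : ℝ) :
    volume {v : Fin n → ℝ | ∑ i, v i ^ 2 ≤ c} =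
      ENNReal.ofReal (√π ^ n / Gamma (n / 2 + 1)) * ENNReal.ofReal ((√c) ^ n) := by
  have : Nonempty (Fin n) := ⟨⟨0, hn⟩⟩
  by_cases hc : 0 ≤ c
  · have h1 := (PiLp.volume_preserving_toLp (Fin n)).measure_preimage
      (measurableSet_closedBall (x := (0 : EuclideanSpace ℝ (Fin n))) (ε := √c)).nullMeasurableSet
    rw [EuclideanSpace.volume_closedBall] at h1
    rw [mul_comm, ENNReal.ofReal_pow (by positivity)]
    convert h1 using 2
    · ext v
      simp [EuclideanSpace.norm_eq, Real.sqrt_le_sqrt_iff hc]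
    · simp
    · simp
  · have : {v : Fin n → ℝ | ∑ i, v i ^ 2 ≤ c} = ∅ := by
      ext v
      simp only [Set.mem_ofPred_eq, Set.mem_empty_iff_false, iff_false]
      have : 0 ≤ ∑ i, v i ^ 2 := Finset.sum_nonneg fun i _ => sq_nonneg _
      linarith
    rw [this, Real.sqrt_eq_zero_of_nonpos (not_le.1 hc).le, zero_pow (by omega)]
    simp

lemma aux_lens (n : ℕ) (hn : 1 ≤ n) (R z : ℝ) (hz : 0 < z) (hzR : z ≤ 2 * R) :
    volume {y : EuclideanSpace ℝ (Fin (n+1)) | ‖y‖ ≤ R ∧ ‖EuclideanSpace.single 0 z + y‖ ≤ R} =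
      ENNReal.ofReal (√π ^ n / Gamma (n / 2 + 1)) *
       ENNReal.ofReal (2 * ∫ s in (z / 2)..R, (√(R ^ 2 - s ^ 2)) ^ n) := by
  have hR : 0 < R := by linarith
  let S : Set (ℝ × (Fin n → ℝ)) :=
    {p | p.1 ^ 2 + ∑ i, p.2 i ^ 2 ≤ R ^ 2 ∧ (z + p.1) ^ 2 + ∑ i, p.2 i ^ 2 ≤ R ^ 2}
  have hS : MeasurableSet S := by
    have a1 : MeasurableSet {p : ℝ × (Fin n → ℝ) | p.1 ^ 2 + ∑ i, p.2 i ^ 2 ≤ R ^ 2} :=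
      measurableSet_le (by fun_prop) measurable_const
    have a2 : MeasurableSet {p : ℝ × (Fin n → ℝ) | (z + p.1) ^ 2 + ∑ i, p.2 i ^ 2 ≤ R ^ 2} :=
      measurableSet_le (by fun_prop) measurable_const
    exact a1.inter a2
  have hmp := (EuclideanSpace.volume_preserving_symm_measurableEquiv_toLp (Fin (n+1))).trans
    (volume_preserving_piFinSuccAbove (fun _ : Fin (n + 1) => ℝ) 0)
  have h1 := hmp.measure_preimage hS.nullMeasurableSet
  have h2 : {y : EuclideanSpace ℝ (Fin (n+1)) | ‖y‖ ≤ R ∧ ‖EuclideanSpace.single 0 z + y‖ ≤ R} =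
      ((MeasurableEquiv.piFinSuccAbove (fun _ : Fin (n + 1) => ℝ) 0) ∘ (MeasurableEquiv.toLp 2 (Fin (n+1) → ℝ)).symm) ⁻¹' S := by
    ext y
    simp only [Set.mem_ofPred_eq, Set.mem_preimage, S, EuclideanSpace.norm_eq, Real.sqrt_le_left hR.le,
      Fin.sum_univ_succ]
    simp [Fin.tail]
  rw [h2]
  refine h1.trans ?_
  rw [Measure.volume_eq_prod, Measure.prod_apply hS, ← aux_slice n R z hz hzR hn,
    ← lintegral_const_mul _ (by fun_prop),
    ← lintegral_add_right_eq_self (fun x => volume (Prod.mk x ⁻¹' S)) (-(z/2))]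
  refine lintegral_congr fun s => ?_
  rw [← aux_euclid n hn]
  congr 1
  ext v
  simp only [S, Set.mem_ofPred_eq, Set.mem_preimage]
  generalize ∑ i, v i ^ 2 = Q
  rcases abs_cases s with ⟨h, h'⟩ | ⟨h, h'⟩ <;> rw [h] <;> constructor
  · rintro ⟨h3, h4⟩; nlinarith
  · intro h3; constructor <;> nlinarith
  · rintro ⟨h3, h4⟩; nlinarith
  · intro h3; constructor <;> nlinarith


lemma aux_real (n : ℕ) (R z : ℝ) (hz : 0 < z) (hzR : z ≤ 2 * R) :
    (√π ^ n / Gamma (n / 2 + 1)) * (2 * ∫ s in (z / 2)..R, (√(R ^ 2 - s ^ 2)) ^ n) =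
     R ^ (n + 1) * (√π ^ (n + 1) / Gamma (((n + 1 : ℕ) : ℝ) / 2 + 1)) *
       regIncBeta (1 - (z / (2 * R)) ^ 2) ((((n + 1 : ℕ) : ℝ) + 1) / 2) (1 / 2) := by
  have hR : 0 < R := by linarith
  have h1 := aux_subst n R (z / 2) (by linarith) (by linarith)
  have e1 : z / (2 * R) = z / 2 / R := by field_simp
  have e2 : (((n + 1 : ℕ) : ℝ) + 1) / 2 - 1 = (n : ℝ) / 2 := by push_cast; ring
  have e3 : (1 / 2 - 1 : ℝ) = -(1/2) := by norm_num
  have e4 : (((n + 1 : ℕ) : ℝ) + 1) / 2 + 1 / 2 = ((n + 1 : ℕ) : ℝ) / 2 + 1 := by ring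
  have e5 : (((n + 1 : ℕ) : ℝ) + 1) / 2 = (n : ℝ) / 2 + 1 := by push_cast; ring
  rw [regIncBeta, e1, e2, e3, h1, e4, e5, Real.Gamma_one_half_eq]
  have g1 : Gamma (((n + 1 : ℕ) : ℝ) / 2 + 1) ≠ 0 := (Real.Gamma_pos_of_pos (by positivity)).ne'
  have g2 : Gamma ((n : ℝ) / 2 + 1) ≠ 0 := (Real.Gamma_pos_of_pos (by positivity)).ne'
  have g3 : √π ≠ 0 := by positivity
  field_simp
  ring

theorem stmt1 (d : ℕ) (hd : 2 ≤ d) (R : ℝ) (hR : 0 < R) :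
    let E := EuclideanSpace ℝ (Fin d)
    let μ : Measure E :=
      (volume (Metric.closedBall (0 : E) R))⁻¹ • volume.restrict (Metric.closedBall (0 : E) R)
    Measure.map (fun p : E × E => ‖p.1 - p.2‖) (μ.prod μ)
      = (volume : Measure ℝ).withDensity (fun z =>
          ENNReal.ofReal (Set.indicator (Set.Icc (0:ℝ) (2 * R))
            (fun z => ((d : ℝ) / R ^ d) * z ^ (d - 1) *
              regIncBeta (1 - (z / (2 * R)) ^ 2) (((d : ℝ) + 1) / 2) (1 / 2)) z)) := by
  obtain ⟨n, rfl⟩ : ∃ n, d = n + 1 := ⟨d - 1, by omega⟩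
  have hn : 1 ≤ n := by omega
  intro E μ
  have hsn : ∀ z : ℝ, ‖(EuclideanSpace.single 0 z : E)‖ = |z| := fun z =>
    (EuclideanSpace.norm_single (𝕜 := ℝ) (0 : Fin (n + 1)) z)
  ext s hs
  set K : ℝ := √π ^ (n + 1) / Gamma (((n + 1 : ℕ) : ℝ) / 2 + 1) with hK
  have hKpos : 0 < K := div_pos (by positivity) (Real.Gamma_pos_of_pos (by positivity))
  have hB : volume (closedBall (0 : E) R) = ENNReal.ofReal (R ^ (n + 1) * K) := by
    rw [EuclideanSpace.volume_closedBall, ENNReal.ofReal_mul (by positivity),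
      ENNReal.ofReal_pow hR.le, Fintype.card_fin]
  have hB1 : volume (ball (0 : E) 1) = ENNReal.ofReal K := by
    rw [EuclideanSpace.volume_ball, Fintype.card_fin]; simp [hK]
  have hm : Measurable (fun p : E × E => ‖p.1 - p.2‖) := by fun_prop
  let L : ℝ → ℝ≥0∞ := fun z =>
    volume {y : E | ‖y‖ ≤ R ∧ ‖EuclideanSpace.single 0 z + y‖ ≤ R}
  have hL : Measurable L := by
    have : MeasurableSet {p : ℝ × E | ‖p.2‖ ≤ R ∧ ‖EuclideanSpace.single 0 p.1 + p.2‖ ≤ R} := by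
      have hc : Continuous fun z : ℝ => (EuclideanSpace.single 0 z : E) :=
        (PiLp.continuous_toLp 2 _).comp (continuous_single (A := fun _ : Fin (n+1) => ℝ) 0)
      have a1 : MeasurableSet {p : ℝ × E | ‖p.2‖ ≤ R} :=
        measurableSet_le (by fun_prop) measurable_const
      have a2 : MeasurableSet {p : ℝ × E | ‖EuclideanSpace.single 0 p.1 + p.2‖ ≤ R} :=
        measurableSet_le
          (((hc.comp continuous_fst).add continuous_snd).norm.measurable) measurable_const
      exact a1.inter a2
    exact measurable_measure_prodMk_left this
  let W : Set (E × E) := {q | ‖q.1‖ ∈ s ∧ ‖q.2‖ ≤ R ∧ ‖q.1 + q.2‖ ≤ R}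
  have hW : MeasurableSet W := by
    have a1 : MeasurableSet {q : E × E | ‖q.2‖ ≤ R} :=
      measurableSet_le (by fun_prop) measurable_const
    have a2 : MeasurableSet {q : E × E | ‖q.1 + q.2‖ ≤ R} :=
      measurableSet_le (by fun_prop) measurable_const
    have a3 : MeasurableSet {q : E × E | ‖q.1‖ ∈ s} := measurable_fst.norm hs
    exact a3.inter (a1.inter a2)
  have hset : (fun p : E × E => ‖p.1 - p.2‖) ⁻¹' s ∩ closedBall (0 : E) R ×ˢ closedBall (0 : E) R =
      (fun z : E × E => (z.1 - z.2, z.2)) ⁻¹' W := by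
    ext ⟨x, y⟩
    simp [W]
    tauto
  have h1 : (volume.prod volume : Measure (E × E)) ((fun p : E × E => ‖p.1 - p.2‖) ⁻¹' s ∩
      closedBall (0 : E) R ×ˢ closedBall (0 : E) R) = ∫⁻ w : E, s.indicator L ‖w‖ := by
    rw [hset, (measurePreserving_sub_prod (volume : Measure E) volume).measure_preimage
      hW.nullMeasurableSet, Measure.prod_apply hW]
    refine lintegral_congr fun w => ?_
    by_cases hw : ‖w‖ ∈ s
    · rw [Set.indicator_of_mem hw]
      have := aux_rot R w (EuclideanSpace.single 0 ‖w‖ : E) (by rw [hsn, abs_norm])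
      refine Eq.trans ?_ this
      congr 1
      ext y
      simp [W, hw]
    · rw [Set.indicator_of_notMem hw]
      have : Prod.mk w ⁻¹' W = ∅ := by
        ext y; simp [W, hw]
      rw [this, measure_empty]
  have : Nontrivial E := by infer_instance
  rw [Measure.map_apply hm hs, Measure.prod_smul_left, Measure.prod_smul_right,
    Measure.prod_restrict, Measure.smul_apply, Measure.smul_apply,
    Measure.restrict_apply (hm hs), h1, aux_polar _ _ (hL.indicator hs), hB, hB1,
    withDensity_apply _ hs, finrank_euclideanSpace_fin]
  simp only [smul_eq_mul, Nat.add_sub_cancel]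
  have hpos : 0 < R ^ (n + 1) * K := by positivity
  rw [← ENNReal.ofReal_inv_of_pos hpos, ← ENNReal.ofReal_natCast,
    ← lintegral_const_mul' _ _ (by finiteness), ← lintegral_const_mul' _ _ (by finiteness),
    ← lintegral_const_mul' _ _ (by finiteness), ← lintegral_indicator measurableSet_Ioi,
    ← lintegral_indicator hs]
  refine lintegral_congr_ae ?_
  have h0 : ∀ᵐ z : ℝ, z ≠ 0 := by simp [ae_iff]
  filter_upwards [h0] with z hz0
  by_cases hzs : z ∈ s
  swap
  · simp [hzs, Set.indicator]
  rw [Set.indicator_of_mem hzs]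
  rcases lt_or_gt_of_ne hz0 with hz | hz
  · rw [Set.indicator_of_notMem (by simpa using hz.le), Set.indicator_of_notMem]
    · simp
    · simp [hz]
  rw [Set.indicator_of_mem (by exact hz), Set.indicator_of_mem hzs]
  by_cases hzR : z ≤ 2 * R
  · rw [Set.indicator_of_mem (Set.mem_Icc.2 ⟨hz.le, hzR⟩)]
    have hG : 0 ≤ √π ^ n / Gamma ((n : ℝ) / 2 + 1) :=
      div_nonneg (by positivity) (Real.Gamma_pos_of_pos (by positivity)).le
    simp only [L]
    rw [aux_lens n hn R z hz hzR, ← ENNReal.ofReal_mul hG, aux_real n R z hz hzR, ← hK,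
      ← ENNReal.ofReal_mul (by positivity), ← ENNReal.ofReal_mul (by positivity),
      ← ENNReal.ofReal_mul (by positivity), ← ENNReal.ofReal_mul (by positivity),
      ← ENNReal.ofReal_mul (by positivity)]
    congr 1
    field_simp
  · rw [Set.indicator_of_notMem (by simp; intro; linarith)]
    have : L z = 0 := by
      simp only [L]
      convert measure_empty (μ := (volume : Measure E))
      ext y
      simp only [Set.mem_ofPred_eq, Set.mem_empty_iff_false, iff_false, not_and, not_le]
      intro hy
      by_contra hc
      have := norm_sub_le (EuclideanSpace.single 0 z + y : E) y
      rw [add_sub_cancel_right, hsn, abs_of_pos hz] at this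
      linarith
    simp [this]
end

section
/- For the one-parameter Mittag–Leffler function E_ν(z) = Σ_{k≥0} z^k / Γ(kν + 1) with ν ∈ (0,1), and every real z ≥ 0: 1/(1 + Γ(1−ν) z) ≤ E_ν(−z) ≤ 1/(1 + z/Γ(1+ν)). -/
open Real

/-- One-parameter Mittag–Leffler function. -/
noncomputable def mittagLeffler (ν z : ℝ) : ℝ := ∑' k : ℕ, z ^ k / Real.Gamma (k * ν + 1)

lemma ml_gamma_lower (R s : ℝ) (hR : 0 < R) (hs : 1 ≤ s) :
    Real.exp (-(R+1)) * R ^ (s-1) ≤ Real.Gamma s := by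
  rw [Real.Gamma_eq_integral (by linarith)]
  have hi := Real.GammaIntegral_convergent (s := s) (by linarith)
  have h1 : ∫ x in Set.Ioc R (R+1), Real.exp (-x) * x ^ (s-1) ≤
      ∫ x in Set.Ioi 0, Real.exp (-x) * x ^ (s-1) := by
    apply MeasureTheory.setIntegral_mono_set hi
    · refine (MeasureTheory.ae_restrict_iff' measurableSet_Ioi).2 (Filter.Eventually.of_forall ?_)
      intro x hx
      have : (0:ℝ) < x := hx
      simp only [Pi.zero_apply]; positivity
    · apply Filter.Eventually.of_forall
      intro x hx
      exact lt_trans hR hx.1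
  refine le_trans ?_ h1
  have h2 : ∫ x in Set.Ioc R (R+1), Real.exp (-(R+1)) * R ^ (s-1) = 
     Real.exp (-(R+1)) * R ^ (s-1) := by
    simp
  rw [← h2]
  apply MeasureTheory.setIntegral_mono_on
  · exact (continuousOn_const.integrableOn_Icc).mono_set Set.Ioc_subset_Icc_self
  · exact hi.mono_set (fun x hx => lt_trans hR hx.1)
  · exact measurableSet_Ioc
  · intro x hx
    apply mul_le_mul
    · exact Real.exp_le_exp.2 (by linarith [hx.2])
    · exact Real.rpow_le_rpow hR.le hx.1.le (by linarith)
    · positivity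
    · positivity

lemma ml_summable (ν β z : ℝ) (hν : 0 < ν) (hβ : 0 < β) (hz : 0 ≤ z) :
    Summable (fun n : ℕ => z ^ n / Real.Gamma (n * ν + β)) := by
  set R : ℝ := (2 * (z+1)) ^ (1/ν) with hRdef
  have hR : 0 < R := by positivity
  have hRν : R ^ ν = 2 * (z+1) := by
    rw [hRdef, ← Real.rpow_mul (by positivity)]
    rw [one_div, inv_mul_cancel₀ hν.ne', Real.rpow_one]
  have hg : Summable (fun n : ℕ => (Real.exp (R+1) * R ^ (1-β)) * (1/2:ℝ) ^ n) :=
    (summable_geometric_of_lt_one (by norm_num) (by norm_num)).mul_left _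
  refine Summable.of_norm_bounded_eventually_nat hg ?_
  obtain ⟨N, hN⟩ := exists_nat_gt (1/ν)
  filter_upwards [Filter.eventually_ge_atTop N] with n hn
  have hn' : (N:ℝ) ≤ n := by exact_mod_cast hn
  have h1 : 1 ≤ n * ν + β := by
    have : 1 < n * ν := by
      rw [div_lt_iff₀ hν] at hN
      nlinarith
    linarith
  have hG := ml_gamma_lower R _ hR h1
  have hGp : 0 < Real.Gamma (n * ν + β) := Real.Gamma_pos_of_pos (by linarith)
  rw [Real.norm_of_nonneg (by positivity), div_le_iff₀ hGp]
  have h3 : z ^ n ≤ (1/2:ℝ)^n * (R ^ ν) ^ n := by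
    rw [hRν, ← mul_pow]
    apply pow_le_pow_left₀ hz
    linarith
  refine h3.trans ?_
  have h4 : (R ^ ν) ^ n = R ^ (1-β) * R ^ (n * ν + β - 1) := by
    rw [← Real.rpow_add hR, ← Real.rpow_natCast, ← Real.rpow_mul hR.le]
    congr 1; ring
  rw [h4]
  have h5 : R ^ (n * ν + β - 1) = Real.exp (R+1) * (Real.exp (-(R+1)) * R ^ (n * ν + β - 1)) := by
    rw [← mul_assoc, ← Real.exp_add]; simp
  rw [h5]
  have : 0 ≤ (1/2:ℝ)^n * R ^ (1-β) * Real.exp (R+1) := by positivity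
  calc _ = ((1/2:ℝ)^n * R ^ (1-β) * Real.exp (R+1)) * (Real.exp (-(R+1)) * R ^ (n * ν + β - 1)) := by ring
    _ ≤ ((1/2:ℝ)^n * R ^ (1-β) * Real.exp (R+1)) * Real.Gamma (n * ν + β) := by gcongr
    _ = _ := by ring

lemma ml_beta (a b t : ℝ) (ha : 0 < a) (hb : 0 < b) (ht : 0 < t) :
    ∫ s in (0:ℝ)..t, s ^ (b-1) * (t-s) ^ (a-1) =
      t ^ (b+a-1) * (Real.Gamma b * Real.Gamma a / Real.Gamma (b+a)) := by
  have h := Complex.betaIntegral_scaled (b:ℂ) (a:ℂ) ht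
  rw [Complex.betaIntegral_eq_Gamma_mul_div _ _ (by simpa) (by simpa)] at h
  rw [← Complex.ofReal_inj, ← intervalIntegral.integral_ofReal]
  have e : ∫ s in (0:ℝ)..t, ((s ^ (b-1) * (t-s) ^ (a-1) : ℝ) : ℂ) =
      ∫ x in (0:ℝ)..t, (x : ℂ) ^ ((b:ℂ) - 1) * ((t : ℂ) - x) ^ ((a:ℂ) - 1) := by
    apply intervalIntegral.integral_congr
    intro s hs
    rw [Set.uIcc_of_le ht.le] at hs
    simp only
    rw [Complex.ofReal_mul, Complex.ofReal_cpow hs.1, Complex.ofReal_cpow (by linarith [hs.2])]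
    push_cast; rfl
  rw [e, h]
  push_cast
  rw [Complex.ofReal_cpow ht.le, ← Complex.Gamma_ofReal, ← Complex.Gamma_ofReal, ← Complex.Gamma_ofReal]
  push_cast
  rfl

lemma ml_beta_int (a b t : ℝ) (ha : 0 < a) (hb : 0 < b) (ht : 0 < t) :
    IntervalIntegrable (fun s => s ^ (b-1) * (t-s) ^ (a-1)) MeasureTheory.volume 0 t := by
  by_contra h
  have h1 := intervalIntegral.integral_undef h
  rw [ml_beta a b t ha hb ht] at h1
  have := Real.Gamma_pos_of_pos ha
  have := Real.Gamma_pos_of_pos hb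
  have := Real.Gamma_pos_of_pos (add_pos hb ha)
  have : 0 < t ^ (b+a-1) * (Real.Gamma b * Real.Gamma a / Real.Gamma (b+a)) := by positivity
  linarith

/-- regular part of the kernel -/
noncomputable def mlP (ν z β s : ℝ) : ℝ := ∑' n : ℕ, (-z) ^ n / Real.Gamma (n * ν + β) * s ^ (n * ν)

lemma ml_term_bound (ν z β s : ℝ) (hν : 0 < ν) (hβ : 0 < β) (hz : 0 ≤ z)
    (hs : s ∈ Set.Icc (0:ℝ) 1) (n : ℕ) :
    ‖(-z) ^ n / Real.Gamma (n * ν + β) * s ^ (n * ν)‖ ≤ z ^ n / Real.Gamma (n * ν + β) := by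
  have hG : 0 < Real.Gamma (n * ν + β) := Real.Gamma_pos_of_pos (by positivity)
  have h1 : s ^ (n * ν) ≤ 1 := Real.rpow_le_one hs.1 hs.2 (by positivity)
  have h2 : 0 ≤ s ^ (n * ν) := Real.rpow_nonneg hs.1 _
  rw [norm_mul, norm_div, norm_pow, norm_neg, Real.norm_of_nonneg hz, Real.norm_of_nonneg hG.le,
    Real.norm_of_nonneg h2]
  exact mul_le_of_le_one_right (by positivity) h1

lemma mlP_cont (ν z β : ℝ) (hν : 0 < ν) (hβ : 0 < β) (hz : 0 ≤ z) :
    ContinuousOn (mlP ν z β) (Set.Icc 0 1) := by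
  unfold mlP
  refine continuousOn_tsum (fun n => ?_) (ml_summable ν β z hν hβ hz)
    (fun n s hs => ml_term_bound ν z β s hν hβ hz hs n)
  apply ContinuousOn.mul continuousOn_const
  exact (Real.continuous_rpow_const (by positivity)).continuousOn

lemma mlP_zero (ν z β : ℝ) (hν : 0 < ν) : mlP ν z β 0 = 1 / Real.Gamma β := by
  unfold mlP
  rw [tsum_eq_single 0]
  · simp
  · intro n hn
    have : (n:ℝ) * ν ≠ 0 := by positivity
    rw [Real.zero_rpow this, mul_zero]

lemma mlP_shift (ν z β s : ℝ) (hν : 0 < ν) (hβ : 0 < β) (hz : 0 ≤ z)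
    (hs : s ∈ Set.Ioc (0:ℝ) 1) :
    mlP ν z β s = 1 / Real.Gamma β - z * s ^ ν * mlP ν z (β + ν) s := by
  have hs' : s ∈ Set.Icc (0:ℝ) 1 := ⟨hs.1.le, hs.2⟩
  have hsum : Summable (fun n : ℕ => (-z) ^ n / Real.Gamma (n * ν + β) * s ^ (n * ν)) :=
    Summable.of_norm_bounded (ml_summable ν β z hν hβ hz) 
      (fun n => ml_term_bound ν z β s hν hβ hz hs' n)
  unfold mlP
  rw [hsum.tsum_eq_zero_add, sub_eq_add_neg, ← neg_mul, ← tsum_mul_left]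
  congr 1
  · simp
  · congr 1; ext n
    have e : ((n + 1 : ℕ) : ℝ) * ν + β = n * ν + (β + ν) := by push_cast; ring
    have e2 : ((n + 1 : ℕ) : ℝ) * ν = n * ν + ν := by push_cast; ring
    rw [e, e2, Real.rpow_add hs.1, pow_succ]
    ring

noncomputable def mlF (ν z β s : ℝ) : ℝ := s ^ (β - 1) * mlP ν z β s

lemma mlF_int (ν z a β t : ℝ) (hν : 0 < ν) (ha : 0 < a) (hβ : 0 < β) (hz : 0 ≤ z)
    (ht : t ∈ Set.Ioc (0:ℝ) 1) :
    IntervalIntegrable (fun s => (t - s) ^ (a-1) * mlF ν z β s) MeasureTheory.volume 0 t := by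
  have h := (ml_beta_int a β t ha hβ ht.1).mul_continuousOn (g := mlP ν z β) 
    ((mlP_cont ν z β hν hβ hz).mono (by 
      rw [Set.uIcc_of_le ht.1.le]; exact Set.Icc_subset_Icc_right ht.2))
  refine h.congr (fun s _ => ?_)
  simp only [mlF]; ring

lemma mlF_conv (ν z a β t : ℝ) (hν : 0 < ν) (ha : 0 < a) (hβ : 0 < β) (hz : 0 ≤ z)
    (ht : t ∈ Set.Ioc (0:ℝ) 1) :
    ∫ s in (0:ℝ)..t, (t - s) ^ (a-1) * mlF ν z β s = Real.Gamma a * mlF ν z (β + a) t := by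
  have hGa := Real.Gamma_pos_of_pos ha
  set G : ℕ → ℝ → ℝ := fun n s => (-z) ^ n / Real.Gamma (n * ν + β) *
    (s ^ ((n * ν + β) - 1) * (t - s) ^ (a-1)) with hG
  have hb : ∀ n : ℕ, 0 < n * ν + β := fun n => by positivity
  have hint : ∀ n, MeasureTheory.Integrable (G n) (MeasureTheory.volume.restrict (Set.Ioc 0 t)) := by
    intro n
    have := (ml_beta_int a (n * ν + β) t ha (hb n) ht.1).const_mul ((-z) ^ n / Real.Gamma (n * ν + β))
    rwa [intervalIntegrable_iff_integrableOn_Ioc_of_le ht.1.le] at this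
  have hval : ∀ n : ℕ, ∫ s in Set.Ioc 0 t, s ^ ((n * ν + β) - 1) * (t - s) ^ (a-1) =
      t ^ (n * ν + β+a-1) * (Real.Gamma (n * ν + β) * Real.Gamma a / Real.Gamma (n * ν + β+a)) := by
    intro n
    rw [← intervalIntegral.integral_of_le ht.1.le, ml_beta a _ t ha (hb n) ht.1]
  have hpow : ∀ n : ℕ, t ^ (n * ν + β + a - 1) = t ^ (β + a - 1) * t ^ (n * ν) := by
    intro n
    rw [← Real.rpow_add ht.1]; congr 1; ring
  have hnorm : ∀ n, ∫ s in Set.Ioc 0 t, ‖G n s‖ = z ^ n / Real.Gamma (n * ν + β) *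
      (t ^ (n * ν + β+a-1) * (Real.Gamma (n * ν + β) * Real.Gamma a / Real.Gamma (n * ν + β+a))) := by
    intro n
    rw [← hval n, ← MeasureTheory.integral_const_mul]
    apply MeasureTheory.setIntegral_congr_fun measurableSet_Ioc
    intro s hs
    have h1 : 0 ≤ s ^ ((n * ν + β) - 1) := Real.rpow_nonneg hs.1.le _
    have h2 : 0 ≤ (t - s) ^ (a-1) := Real.rpow_nonneg (by linarith [hs.2]) _
    simp only [hG]
    rw [norm_mul, norm_div, norm_pow, norm_neg, Real.norm_of_nonneg hz,
      Real.norm_of_nonneg (Real.Gamma_pos_of_pos (hb n)).le, Real.norm_of_nonneg (mul_nonneg h1 h2)]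
  have hsum : Summable fun n => ∫ s in Set.Ioc 0 t, ‖G n s‖ := by
    have h0 := (ml_summable ν (β + a) z hν (by positivity) hz).mul_left (Real.Gamma a * t ^ (β+a-1))
    refine Summable.of_nonneg_of_le (fun n => ?_) (fun n => ?_) h0
    · exact MeasureTheory.integral_nonneg (fun s => norm_nonneg _)
    · rw [hnorm, hpow]
      have g1 := Real.Gamma_pos_of_pos (hb n)
      have g2 : 0 < Real.Gamma (n * ν + β + a) := Real.Gamma_pos_of_pos (by linarith [hb n])
      have h1 : t ^ (n * ν) ≤ 1 := Real.rpow_le_one ht.1.le ht.2 (by positivity)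
      have h3 : 0 ≤ t ^ (β + a - 1) := Real.rpow_nonneg ht.1.le _
      rw [← add_assoc]
      calc _ = (Real.Gamma a * t ^ (β+a-1) * (z ^ n / Real.Gamma (n * ν + β + a))) * t ^ (n * ν) := by
            field_simp
        _ ≤ _ := mul_le_of_le_one_right (by positivity) h1
  have hs := MeasureTheory.hasSum_integral_of_summable_integral_norm hint hsum
  have e1 : ∫ s in Set.Ioc 0 t, ∑' n, G n s = ∫ s in (0:ℝ)..t, (t - s) ^ (a-1) * mlF ν z β s := by
    rw [intervalIntegral.integral_of_le ht.1.le]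
    apply MeasureTheory.setIntegral_congr_fun measurableSet_Ioc
    intro s hs
    simp only [hG, mlF, mlP]
    rw [← tsum_mul_left, ← tsum_mul_left]
    congr 1; ext n
    have : (n * ν + β) - 1 = (β - 1) + n * ν := by ring
    rw [this, Real.rpow_add hs.1]; ring
  rw [← e1, ← hs.tsum_eq]
  simp only [mlF, mlP]
  rw [← tsum_mul_left, ← tsum_mul_left]
  congr 1; ext n
  simp only [hG]
  rw [MeasureTheory.integral_const_mul, hval, hpow]
  have g1 := Real.Gamma_pos_of_pos (hb n)
  rw [← add_assoc]
  field_simp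

lemma mlF_shift (ν z β s : ℝ) (hν : 0 < ν) (hβ : 0 < β) (hz : 0 ≤ z)
    (hs : s ∈ Set.Ioc (0:ℝ) 1) :
    mlF ν z β s = s ^ (β - 1) / Real.Gamma β - z * mlF ν z (β + ν) s := by
  unfold mlF
  rw [mlP_shift ν z β s hν hβ hz hs]
  have : β + ν - 1 = (β - 1) + ν := by ring
  rw [this, Real.rpow_add hs.1]; ring

lemma mlP_pos (ν z : ℝ) (hν : ν ∈ Set.Ioo (0:ℝ) 1) (hz : 0 ≤ z) :
    ∀ t ∈ Set.Icc (0:ℝ) 1, 0 < mlP ν z ν t := by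
  have hν0 := hν.1
  have hν1 := hν.2
  have hΓ : 0 < Real.Gamma ν := Real.Gamma_pos_of_pos hν0
  by_contra hcon
  push Not at hcon
  have hc := mlP_cont ν z ν hν0 hν0 hz
  have hcl : IsClosed (Set.Icc (0:ℝ) 1 ∩ mlP ν z ν ⁻¹' Set.Iic 0) :=
    hc.preimage_isClosed_of_isClosed isClosed_Icc isClosed_Iic
  have hcomp : IsCompact (Set.Icc (0:ℝ) 1 ∩ mlP ν z ν ⁻¹' Set.Iic 0) :=
    isCompact_Icc.of_isClosed_subset hcl Set.inter_subset_left
  obtain ⟨t', ht'1, ht'2⟩ := hcon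
  obtain ⟨t0, ⟨ht0, ht0p⟩, hleast⟩ := hcomp.exists_isLeast ⟨t', ht'1, ht'2⟩
  have ht0p' : mlP ν z ν t0 ≤ 0 := ht0p
  have hpos : ∀ s, 0 ≤ s → s < t0 → 0 < mlP ν z ν s := by
    intro s hs hst
    by_contra h
    have := hleast (a := s) ⟨⟨hs, hst.le.trans ht0.2⟩, not_lt.1 h⟩
    linarith
  have ht0pos : 0 < t0 := by
    rcases ht0.1.lt_or_eq with h | h
    · exact h
    · rw [← h, mlP_zero ν z ν hν0] at ht0p'
      have : 0 < 1 / Real.Gamma ν := by positivity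
      linarith
  set g := mlF ν z ν with hg
  have hgpos : ∀ s, 0 < s → s < t0 → 0 < g s := fun s h1 h2 =>
    mul_pos (Real.rpow_pos_of_pos h1 _) (hpos s h1.le h2)
  have hg0 : g t0 ≤ 0 := mul_nonpos_of_nonneg_of_nonpos (Real.rpow_nonneg ht0.1 _) ht0p'
  -- Volterra equation
  have hV : ∀ t ∈ Set.Ioc (0:ℝ) 1, Real.Gamma ν * g t =
      t ^ (ν - 1) - z * ∫ s in (0:ℝ)..t, (t - s) ^ (ν - 1) * g s := by
    intro t ht
    rw [mlF_conv ν z ν ν t hν0 hν0 hν0 hz ht, hg, mlF_shift ν z ν t hν0 hν0 hz ht]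
    field_simp
  set δ : ℝ := ((ν * Real.Gamma ν / 4) / (z + 1)) ^ (1 / ν) with hδ
  have hδ0 : 0 < δ := by positivity
  have hδν : δ ^ ν = (ν * Real.Gamma ν / 4) / (z + 1) := by
    rw [hδ, ← Real.rpow_mul (by positivity), one_div, inv_mul_cancel₀ hν0.ne', Real.rpow_one]
  set t1 := max (t0 / 2) (t0 - δ) with ht1
  have ht1a : t0 / 2 ≤ t1 := le_max_left _ _
  have ht1b : t0 - δ ≤ t1 := le_max_right _ _
  have ht1c : t1 < t0 := max_lt (by linarith) (by linarith)
  have hgc : ContinuousOn g (Set.Icc t1 t0) := by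
    apply ContinuousOn.mul
    · apply ContinuousOn.rpow_const continuousOn_id
      intro x hx
      left
      have := hx.1
      simp only [id]
      linarith
    · exact hc.mono (Set.Icc_subset_Icc (by linarith) ht0.2)
  obtain ⟨r, hr, hmax⟩ := isCompact_Icc.exists_isMaxOn (Set.nonempty_Icc.2 ht1c.le) hgc
  have hmax' : ∀ s ∈ Set.Icc t1 t0, g s ≤ g r := fun s hs => hmax hs
  have hgr : 0 < g r := lt_of_lt_of_le (hgpos t1 (by linarith) ht1c) 
    (hmax' t1 ⟨le_rfl, ht1c.le⟩)
  have hr0 : r < t0 := by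
    rcases hr.2.lt_or_eq with h | h
    · exact h
    · rw [h] at hgr; linarith
  have hrpos : 0 < r := by linarith [hr.1]
  have hint0 := mlF_int ν z ν ν t0 hν0 hν0 hν0 hz ⟨ht0pos, ht0.2⟩
  have hintr := mlF_int ν z ν ν r hν0 hν0 hν0 hz ⟨hrpos, hr0.le.trans ht0.2⟩
  have hV0 := hV t0 ⟨ht0pos, ht0.2⟩
  have hVr := hV r ⟨hrpos, hr0.le.trans ht0.2⟩
  have i1 : IntervalIntegrable (fun s => (t0 - s) ^ (ν-1) * g s) MeasureTheory.volume 0 r :=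
    hint0.mono_set (by
      rw [Set.uIcc_of_le hrpos.le, Set.uIcc_of_le ht0pos.le]; exact Set.Icc_subset_Icc_right hr0.le)
  have i2 : IntervalIntegrable (fun s => (t0 - s) ^ (ν-1) * g s) MeasureTheory.volume r t0 :=
    hint0.mono_set (by
      rw [Set.uIcc_of_le hr0.le, Set.uIcc_of_le ht0pos.le]; exact Set.Icc_subset_Icc_left hrpos.le)
  rw [← intervalIntegral.integral_add_adjacent_intervals i1 i2] at hV0
  set c := (t0 / r) ^ (ν - 1) with hcdef
  have hA : ∫ s in (0:ℝ)..r, (t0 - s) ^ (ν-1) * g s ≤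
      c * ∫ s in (0:ℝ)..r, (r - s) ^ (ν-1) * g s := by
    rw [← intervalIntegral.integral_const_mul]
    apply intervalIntegral.integral_mono_on_of_le_Ioo hrpos.le i1 (hintr.const_mul c)
    intro s hs
    rw [← mul_assoc]
    have hs1 := hs.1
    have hs2 := hs.2
    apply mul_le_mul_of_nonneg_right _ (hgpos s hs1 (by linarith)).le
    rw [hcdef, ← Real.mul_rpow (by positivity) (by linarith)]
    apply Real.rpow_le_rpow_of_nonpos
    · have : 0 < r - s := by linarith
      positivity
    · rw [div_mul_eq_mul_div, div_le_iff₀ hrpos]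
      nlinarith
    · linarith
  have i3 : IntervalIntegrable (fun s => (t0 - s) ^ (ν-1)) MeasureTheory.volume r t0 := by
    have := (intervalIntegral.intervalIntegrable_rpow' (a := t0 - r) (b := t0 - t0) 
      (r := ν - 1) (by linarith)).comp_sub_left t0
    simpa using this
  have hD : ∫ s in r..t0, (t0 - s) ^ (ν-1) = (t0 - r) ^ ν / ν := by
    rw [intervalIntegral.integral_comp_sub_left (fun x => x ^ (ν - 1)) t0,
      integral_rpow (Or.inl (by linarith))]
    simp [Real.zero_rpow hν0.ne']
  have hB : ∫ s in r..t0, (t0 - s) ^ (ν-1) * g s ≤ (t0 - r) ^ ν / ν * g r := by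
    rw [← hD, ← intervalIntegral.integral_mul_const]
    apply intervalIntegral.integral_mono_on hr0.le i2 (i3.mul_const _)
    intro s hs
    apply mul_le_mul_of_nonneg_left (hmax' s ⟨hr.1.trans hs.1, hs.2⟩)
    exact Real.rpow_nonneg (by linarith [hs.2]) _
  have hcr : c * r ^ (ν - 1) = t0 ^ (ν - 1) := by
    rw [hcdef, ← Real.mul_rpow (by positivity) (by positivity), div_mul_cancel₀ _ hrpos.ne']
  have hchalf : 1 / 2 ≤ c := by
    have h1 : 1 ≤ t0 / r := by rw [le_div_iff₀ hrpos]; linarith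
    have h2 : t0 / r ≤ 2 := by rw [div_le_iff₀ hrpos]; linarith [hr.1]
    calc (1/2:ℝ) ≤ (t0 / r)⁻¹ := by
          rw [one_div]; exact inv_anti₀ (by positivity) h2
      _ = (t0 / r) ^ (-1:ℝ) := by rw [Real.rpow_neg_one]
      _ ≤ c := Real.rpow_le_rpow_of_exponent_le h1 (by linarith)
  have hzD : z * ((t0 - r) ^ ν / ν) ≤ Real.Gamma ν / 4 := by
    have h1 : (t0 - r) ^ ν ≤ δ ^ ν := Real.rpow_le_rpow (by linarith) (by linarith [hr.1]) hν0.le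
    rw [hδν] at h1
    calc z * ((t0 - r) ^ ν / ν) ≤ z * ((ν * Real.Gamma ν / 4) / (z + 1) / ν) := by gcongr
      _ = (z / (z+1)) * (Real.Gamma ν / 4) := by field_simp
      _ ≤ 1 * (Real.Gamma ν / 4) := by
          gcongr
          rw [div_le_one (by positivity)]; linarith
      _ = _ := one_mul _
  have k1 := mul_le_mul_of_nonneg_left (add_le_add hA hB) hz
  have k2 : Real.Gamma ν * g t0 ≤ 0 := mul_nonpos_of_nonneg_of_nonpos hΓ.le hg0
  have k3 : c * (Real.Gamma ν * g r) ≤ z * ((t0 - r) ^ ν / ν) * g r := by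
    rw [hVr]; linarith
  have k4 : z * ((t0 - r) ^ ν / ν) * g r ≤ Real.Gamma ν / 4 * g r := by gcongr
  have k5 : 1 / 2 * (Real.Gamma ν * g r) ≤ c * (Real.Gamma ν * g r) := by gcongr
  have k6 : 0 < Real.Gamma ν * g r := by positivity
  linarith


theorem stmt6 (ν : ℝ) (hν : ν ∈ Set.Ioo (0:ℝ) 1) (z : ℝ) (hz : 0 ≤ z) :
    1 / (1 + Real.Gamma (1 - ν) * z) ≤ mittagLeffler ν (-z) ∧
    mittagLeffler ν (-z) ≤ 1 / (1 + z / Real.Gamma (1 + ν)) := by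
  have hν0 := hν.1
  have hν1 := hν.2
  have hΓ : 0 < Real.Gamma ν := Real.Gamma_pos_of_pos hν0
  have hΓ1 : 0 < Real.Gamma (1 + ν) := Real.Gamma_pos_of_pos (by linarith)
  have hΓ2 : 0 < Real.Gamma (1 - ν) := Real.Gamma_pos_of_pos (by linarith)
  have h11 : (1:ℝ) ∈ Set.Ioc (0:ℝ) 1 := ⟨one_pos, le_rfl⟩
  have hE : mittagLeffler ν (-z) = mlF ν z 1 1 := by
    simp [mittagLeffler, mlF, mlP]
  have hgpos : ∀ s ∈ Set.Icc (0:ℝ) 1, 0 ≤ mlF ν z ν s := fun s hs =>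
    mul_nonneg (Real.rpow_nonneg hs.1 _) (mlP_pos ν z hν hz s hs).le
  -- f = 1 - z h
  have hf : ∀ t ∈ Set.Ioc (0:ℝ) 1, mlF ν z 1 t = 1 - z * mlF ν z (1 + ν) t := by
    intro t ht
    have := mlF_shift ν z 1 t hν0 one_pos hz ht
    simpa using this
  have hh : ∀ t ∈ Set.Ioc (0:ℝ) 1, ∫ s in (0:ℝ)..t, mlF ν z ν s = mlF ν z (1 + ν) t := by
    intro t ht
    have := mlF_conv ν z 1 ν t hν0 one_pos hν0 hz ht
    simpa [add_comm] using this
  have hgint : ∀ t ∈ Set.Ioc (0:ℝ) 1, IntervalIntegrable (mlF ν z ν) MeasureTheory.volume 0 t := by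
    intro t ht
    have := mlF_int ν z 1 ν t hν0 one_pos hν0 hz ht
    simpa using this
  have hanti : ∀ t ∈ Set.Ioc (0:ℝ) 1, mlF ν z 1 1 ≤ mlF ν z 1 t := by
    intro t ht
    rw [hf t ht, hf 1 h11, ← hh t ht, ← hh 1 h11]
    have : ∫ s in (0:ℝ)..t, mlF ν z ν s ≤ ∫ s in (0:ℝ)..1, mlF ν z ν s := by
      apply intervalIntegral.integral_mono_interval le_rfl ht.1.le ht.2 _ (hgint 1 h11)
      refine (MeasureTheory.ae_restrict_iff' measurableSet_Ioc).2 (Filter.Eventually.of_forall ?_)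
      intro s hs
      exact hgpos s ⟨hs.1.le, hs.2⟩
    have := mul_le_mul_of_nonneg_left this hz
    linarith
  -- upper
  have hU : mlF ν z 1 1 ≤ Real.Gamma (1 + ν) * mlF ν z (1 + ν) 1 := by
    have e := mlF_conv ν z ν 1 1 hν0 hν0 one_pos hz h11
    have hi := mlF_int ν z ν 1 1 hν0 hν0 one_pos hz h11
    have i3 : IntervalIntegrable (fun s : ℝ => (1 - s) ^ (ν-1)) MeasureTheory.volume 0 1 := by
      have := ml_beta_int ν 1 1 hν0 one_pos one_pos
      simpa using this
    have hD : ∫ s in (0:ℝ)..1, (1 - s) ^ (ν-1) = 1 / ν := by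
      rw [intervalIntegral.integral_comp_sub_left (fun x => x ^ (ν - 1)) 1,
        integral_rpow (Or.inl (by linarith))]
      simp [Real.zero_rpow hν0.ne']
    have hle : ∫ s in (0:ℝ)..1, (1 - s) ^ (ν-1) * mlF ν z 1 1 ≤
        ∫ s in (0:ℝ)..1, (1 - s) ^ (ν-1) * mlF ν z 1 s := by
      apply intervalIntegral.integral_mono_on_of_le_Ioo zero_le_one (i3.mul_const _) hi
      intro s hs
      apply mul_le_mul_of_nonneg_left (hanti s ⟨hs.1, hs.2.le⟩)
      exact Real.rpow_nonneg (by linarith [hs.2]) _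
    rw [intervalIntegral.integral_mul_const, hD, e] at hle
    rw [add_comm 1 ν, Real.Gamma_add_one hν0.ne', add_comm ν 1]
    calc mlF ν z 1 1 = ν * (1 / ν * mlF ν z 1 1) := by field_simp
      _ ≤ ν * (Real.Gamma ν * mlF ν z (1 + ν) 1) := by gcongr
      _ = _ := by ring
  have hL : mlF ν z (1 + ν) 1 ≤ Real.Gamma (1 - ν) * mlF ν z 1 1 := by
    have e := mlF_conv ν z (1 - ν) ν 1 hν0 (by linarith) hν0 hz h11
    have hi := mlF_int ν z (1 - ν) ν 1 hν0 (by linarith) hν0 hz h11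
    rw [add_sub_cancel] at e
    rw [← e, ← hh 1 h11]
    apply intervalIntegral.integral_mono_on_of_le_Ioo zero_le_one (hgint 1 h11) hi
    intro s hs
    apply le_mul_of_one_le_left (hgpos s ⟨hs.1.le, hs.2.le⟩)
    exact Real.one_le_rpow_of_pos_of_le_one_of_nonpos (by linarith [hs.2]) (by linarith [hs.1])
      (by linarith)
  have hfe := hf 1 h11
  rw [hE]
  constructor
  · rw [div_le_iff₀ (by positivity)]
    have := mul_le_mul_of_nonneg_left hL hz
    linarith
  · rw [le_div_iff₀ (by positivity)]
    have h1 : mlF ν z 1 1 / Real.Gamma (1 + ν) ≤ mlF ν z (1 + ν) 1 := by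
      rw [div_le_iff₀ hΓ1]; linarith
    have h2 := mul_le_mul_of_nonneg_left h1 hz
    calc _ = mlF ν z 1 1 + z * (mlF ν z 1 1 / Real.Gamma (1 + ν)) := by ring
      _ ≤ _ := by linarith
end

section
/- Let Z be a centered, unit-variance, mean-square continuous Gaussian field on ℝ^d × ℝ, homogeneous-isotropic in space and stationary in time with nonnegative covariance C(z,τ) satisfying: (i) C(z,τ) → 0 as max(z,τ) → ∞, and (ii) σ_{1,K}²(T)/(T^{1+δ₁} T^{γd(1+δ₂)}) → ∞ for some δ₁, δ₂ ∈ (0,1), where σ_{1,K}²(T) = Var(∫₀^T ∫_{T^γK} Z(x,t) dx dt). Then for any fixed u ∈ ℝ, the normalized first Minkowski functional (M₁(T) − (1−Φ(u))|K|T^{1+γd}) / (φ(u) σ_{1,K}(T)) converges in distribution to a standard normal random variable as T → ∞, where M₁(T) = ∫₀^T ∫_{T^γK} 1_{Z(x,t) ≥ u} dx dt. -/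
open Real MeasureTheory ProbabilityTheory Pointwise Filter BoundedContinuousFunction

variable {Ω : Type*} [MeasurableSpace Ω]

/-- A centered spatiotemporal random field `Z` is Gaussian with stationary covariance
`C(‖x−y‖,|t−s|)` if every finite linear combination of its values is a centered Gaussian. -/
def IsGaussianField {d : ℕ} (P : Measure Ω)
    (Z : EuclideanSpace ℝ (Fin d) → ℝ → Ω → ℝ) (C : ℝ → ℝ → ℝ) : Prop :=
  ∀ (n : ℕ) (c : Fin n → ℝ) (x : Fin n → EuclideanSpace ℝ (Fin d)) (t : Fin n → ℝ),
    Measure.map (fun ω => ∑ i, c i * Z (x i) (t i) ω) P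
      = gaussianReal 0 (Real.toNNReal (∑ i, ∑ j, c i * c j * C ‖x i - x j‖ |t i - t j|))

/-- Standard Gaussian density. -/
noncomputable def gphi (y : ℝ) : ℝ := (1 / Real.sqrt (2 * π)) * Real.exp (-y ^ 2 / 2)

/-- Standard Gaussian CDF. -/
noncomputable def gPhi (u : ℝ) : ℝ := ∫ w in Set.Iic u, gphi w

lemma gphi_eq (y : ℝ) : gphi y = gaussianPDFReal 0 1 y := by
  simp [gphi, gaussianPDFReal]

lemma gphi_pos (y : ℝ) : 0 < gphi y := by
  rw [gphi_eq]; exact gaussianPDFReal_pos _ _ _ one_ne_zero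

lemma gphi_cont : Continuous gphi := by
  unfold gphi; fun_prop

lemma gphi_le_one (y : ℝ) : gphi y ≤ 1 := by
  unfold gphi
  have h1 : 1 ≤ Real.sqrt (2 * π) := by
    rw [Real.one_le_sqrt]; nlinarith [Real.pi_gt_three]
  have h2 : Real.exp (-y ^ 2 / 2) ≤ 1 := by
    rw [Real.exp_le_one_iff]; nlinarith [sq_nonneg y]
  have h3 : 1 / Real.sqrt (2 * π) ≤ 1 := by
    rw [div_le_one (by positivity)]; exact h1
  have := Real.exp_pos (-y ^ 2 / 2)
  have h4 : 0 ≤ 1 / Real.sqrt (2 * π) := by positivity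
  nlinarith

lemma gphi_integrable : Integrable gphi := by
  have : gphi = gaussianPDFReal 0 1 := funext gphi_eq
  rw [this]; exact integrable_gaussianPDFReal _ _

lemma gPhi_hasDerivAt (a : ℝ) : HasDerivAt gPhi (gphi a) a := by
  have h : gPhi = fun v => gPhi 0 + ∫ w in (0:ℝ)..v, gphi w := by
    funext v
    have := intervalIntegral.integral_Iic_sub_Iic (μ := volume) (f := gphi) (a := 0) (b := v)
      gphi_integrable.integrableOn gphi_integrable.integrableOn
    unfold gPhi
    linarith
  rw [h]
  exact (intervalIntegral.integral_hasDerivAt_right (gphi_integrable.intervalIntegrable)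
    (gphi_cont.stronglyMeasurableAtFilter _ _) gphi_cont.continuousAt).const_add _

lemma gauss_Ici (a : ℝ) : (gaussianReal 0 1).real (Set.Ici a) = 1 - gPhi a := by
  have h1 : (gaussianReal 0 1).real (Set.Iio a) = gPhi a := by
    rw [measureReal_def, gaussianReal_apply_eq_integral 0 one_ne_zero,
      ENNReal.toReal_ofReal (integral_nonneg fun x => gaussianPDFReal_nonneg _ _ _)]
    unfold gPhi
    rw [integral_Iic_eq_integral_Iio]
    simp_rw [gphi_eq]
  have h2 : (Set.Ici a) = (Set.Iio a)ᶜ := by simp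
  rw [h2, probReal_compl_eq_one_sub measurableSet_Iio, h1]

/-- The centered indicator with its linear part removed. -/
noncomputable def gg (u x : ℝ) : ℝ :=
  Set.indicator (Set.Ici u) (fun _ => (1:ℝ)) x - (1 - gPhi u) - gphi u * x

lemma gg_meas (u : ℝ) : Measurable (gg u) := by
  unfold gg
  have : Measurable (Set.indicator (Set.Ici u) (fun _ : ℝ => (1:ℝ))) :=
    measurable_const.indicator measurableSet_Ici
  fun_prop

lemma id_memLp : MemLp (fun x : ℝ => x) 2 (gaussianReal 0 1) :=
  memLp_id_gaussianReal 2

lemma ind_memLp (u : ℝ) {Ω : Type*} [MeasurableSpace Ω] (P : Measure Ω) [IsFiniteMeasure P]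
    (X : Ω → ℝ) (hX : Measurable X) (p : ENNReal) :
    MemLp (fun ω => Set.indicator (Set.Ici u) (fun _ => (1:ℝ)) (X ω)) p P := by
  have h0 : Measurable (Set.indicator (Set.Ici u) (fun _ : ℝ => (1:ℝ))) :=
    measurable_const.indicator measurableSet_Ici
  refine MemLp.of_bound (h0.comp hX).aestronglyMeasurable 1 (ae_of_all _ fun ω => ?_)
  by_cases h : X ω ∈ Set.Ici u <;> simp [h]

lemma gg_memLp (u : ℝ) : MemLp (gg u) 2 (gaussianReal 0 1) :=
  ((ind_memLp u _ (fun x => x) measurable_id 2).sub (memLp_const _)).sub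
    (id_memLp.const_mul (gphi u))

/-- The covariance of the reduced indicator as function of the correlation. -/
noncomputable def GG (u r : ℝ) : ℝ :=
  ∫ x, gg u x * ∫ w, gg u (r * x + Real.sqrt (1 - r ^ 2) * w) ∂(gaussianReal 0 1) ∂(gaussianReal 0 1)

noncomputable def kk (u r x : ℝ) : ℝ :=
  (1 - gPhi ((u - r * x) / Real.sqrt (1 - r ^ 2))) - (1 - gPhi u) - gphi u * (r * x)

lemma inner_eq (u r x : ℝ) (hr : r ^ 2 < 1) :
    ∫ w, gg u (r * x + Real.sqrt (1 - r ^ 2) * w) ∂(gaussianReal 0 1) = kk u r x := by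
  set s := Real.sqrt (1 - r ^ 2) with hs
  have hs0 : 0 < s := Real.sqrt_pos.2 (by linarith)
  unfold gg kk
  have hi1 : Integrable (fun w : ℝ => Set.indicator (Set.Ici u) (fun _ => (1:ℝ)) (r * x + s * w))
      (gaussianReal 0 1) := by
    have := ind_memLp u (gaussianReal 0 1) (fun w => r * x + s * w) (by fun_prop) 1
    exact memLp_one_iff_integrable.1 this
  have hid : Integrable (fun w : ℝ => w) (gaussianReal 0 1) := id_memLp.integrable (by norm_num)
  have hi2 : Integrable (fun w : ℝ => Set.indicator (Set.Ici u) (fun _ => (1:ℝ)) (r * x + s * w)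
      - (1 - gPhi u)) (gaussianReal 0 1) := hi1.sub (integrable_const _)
  have hi3 : Integrable (fun w : ℝ => s * w) (gaussianReal 0 1) := hid.const_mul s
  have hi4 : Integrable (fun w : ℝ => r * x + s * w) (gaussianReal 0 1) :=
    (integrable_const _).add hi3
  rw [integral_sub hi2 (hi4.const_mul _), integral_sub hi1 (integrable_const _)]
  rw [integral_const_mul, integral_add (integrable_const _) hi3,
    integral_const_mul s, integral_id_gaussianReal]
  have : (fun w : ℝ => Set.indicator (Set.Ici u) (fun _ => (1:ℝ)) (r * x + s * w))
      = Set.indicator (Set.Ici ((u - r * x) / s)) (fun _ => (1:ℝ)) := by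
    funext w
    simp only [Set.indicator, Set.mem_Ici]
    congr 1
    rw [div_le_iff₀ hs0, eq_iff_iff]
    constructor <;> intro h <;> linarith
  rw [this, integral_indicator measurableSet_Ici]
  simp only [integral_const, measureReal_restrict_apply_univ, gauss_Ici, smul_eq_mul]
  simp [← hs]

lemma kk_hasDeriv (u r x : ℝ) (hr : r ^ 2 < 1) :
    HasDerivAt (fun r => kk u r x)
      (-(gphi ((u - r * x) / Real.sqrt (1 - r ^ 2)) *
        ((-x * Real.sqrt (1 - r ^ 2) + (u - r * x) * (r / Real.sqrt (1 - r ^ 2))) / (1 - r ^ 2)))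
          - gphi u * x) r := by
  have hs0 : 0 < Real.sqrt (1 - r ^ 2) := Real.sqrt_pos.2 (by linarith)
  have hsq : Real.sqrt (1 - r ^ 2) ^ 2 = 1 - r ^ 2 := Real.sq_sqrt (by linarith)
  have h1 : HasDerivAt (fun r : ℝ => Real.sqrt (1 - r ^ 2)) (-(r / Real.sqrt (1 - r ^ 2))) r := by
    have h := ((hasDerivAt_pow 2 r).const_sub 1).sqrt (by linarith : (1 - r ^ 2) ≠ 0)
    convert h using 1
    field_simp
    simp [mul_comm]
  have h2 : HasDerivAt (fun r : ℝ => u - r * x) (-x) r := by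
    simpa using ((hasDerivAt_id r).mul_const x).const_sub u
  have h3 := h2.div h1 hs0.ne'
  have h4 := ((gPhi_hasDerivAt _).comp r h3)
  have h5 : HasDerivAt (fun r : ℝ => gphi u * (r * x)) (gphi u * x) r := by
    simpa using ((hasDerivAt_id r).mul_const x).const_mul (gphi u)
  have h6 := ((h4.const_sub 1).sub_const (1 - gPhi u)).sub h5
  unfold kk
  refine h6.congr_deriv ?_
  rw [hsq]
  simp only [Pi.div_apply]
  ring

lemma kk_deriv_bound (u r x : ℝ) (hr : |r| < 1 / 2) :
    |(-(gphi ((u - r * x) / Real.sqrt (1 - r ^ 2)) *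
        ((-x * Real.sqrt (1 - r ^ 2) + (u - r * x) * (r / Real.sqrt (1 - r ^ 2))) / (1 - r ^ 2)))
          - gphi u * x)| ≤ 4 * |u| + 5 * |x| := by
  have hr2 : r ^ 2 < 1 / 4 := by
    have := abs_lt.1 hr; nlinarith
  set s := Real.sqrt (1 - r ^ 2) with hs
  have hs1 : s ≤ 1 := by rw [hs, Real.sqrt_le_left (by norm_num)]; nlinarith [sq_nonneg r]
  have hs2 : 1 / 2 < s := by rw [hs]; apply Real.lt_sqrt_of_sq_lt; linarith
  have hp0 := gphi_pos ((u - r * x) / s)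
  have hp1 := gphi_le_one ((u - r * x) / s)
  have hq0 := gphi_pos u
  have hq1 := gphi_le_one u
  have hrs : |r / s| ≤ 1 := by
    rw [abs_div, abs_of_pos (by linarith : 0 < s), div_le_one (by linarith)]; linarith
  have hux : |u - r * x| ≤ |u| + |x| := by
    refine (abs_sub _ _).trans ?_
    rw [abs_mul]; nlinarith [abs_nonneg x]
  have hnum : |(-x * s + (u - r * x) * (r / s))| ≤ |u| + 2 * |x| := by
    refine (abs_add_le _ _).trans ?_
    rw [abs_mul, abs_mul, abs_neg, abs_of_pos (by linarith : 0 < s)]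
    nlinarith [abs_nonneg x, abs_nonneg (u - r * x), abs_nonneg (r / s)]
  have hq : |(-x * s + (u - r * x) * (r / s)) / (1 - r ^ 2)| ≤ 2 * (|u| + 2 * |x|) := by
    rw [abs_div, abs_of_pos (by linarith : 0 < 1 - r ^ 2), div_le_iff₀ (by linarith)]
    nlinarith [abs_nonneg x, abs_nonneg u]
  refine (abs_sub _ _).trans ?_
  rw [abs_neg, abs_mul, abs_mul, abs_of_pos hp0, abs_of_pos hq0]
  nlinarith [abs_nonneg x, abs_nonneg u,
    abs_nonneg ((-x * s + (u - r * x) * (r / s)) / (1 - r ^ 2))]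

lemma kk_zero (u x : ℝ) : kk u 0 x = 0 := by simp [kk]

lemma gPhi_cont : Continuous gPhi :=
  continuous_iff_continuousAt.2 fun a => (gPhi_hasDerivAt a).continuousAt

lemma GG_hasDeriv (u : ℝ) : HasDerivAt (GG u) 0 0 := by
  have hev : GG u =ᶠ[nhds 0] fun r => ∫ x, gg u x * kk u r x ∂(gaussianReal 0 1) := by
    filter_upwards [Metric.ball_mem_nhds (0:ℝ) (by norm_num : (0:ℝ) < 1 / 2)] with r hr
    have hr' : |r| < 1 / 2 := by simpa [Real.dist_eq] using hr
    have hr2 : r ^ 2 < 1 := by have := abs_lt.1 hr'; nlinarith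
    unfold GG
    simp_rw [inner_eq u r _ hr2]
  refine HasDerivAt.congr_of_eventuallyEq ?_ hev
  have hb : Integrable (fun x => |gg u x| * (4 * |u| + 5 * |x|)) (gaussianReal 0 1) := by
    have h1 : MemLp (fun x : ℝ => (4 * |u| + 5 * |x|)) 2 (gaussianReal 0 1) :=
      (memLp_const (4 * |u|)).add ((id_memLp.norm).const_mul 5)
    have h2 : MemLp (fun x : ℝ => |gg u x|) 2 (gaussianReal 0 1) := (gg_memLp u).norm
    exact h2.integrable_mul h1
  have hkm : ∀ r : ℝ, Measurable (fun x => kk u r x) := by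
    intro r
    unfold kk
    have := gPhi_cont.measurable
    fun_prop
  have key := hasDerivAt_integral_of_dominated_loc_of_deriv_le (μ := gaussianReal 0 1) (𝕜 := ℝ)
    (F := fun r x => gg u x * kk u r x) (x₀ := (0:ℝ)) (s := Metric.ball 0 (1/2))
    (bound := fun x => |gg u x| * (4 * |u| + 5 * |x|))
    (F' := fun r x => gg u x * (-(gphi ((u - r * x) / Real.sqrt (1 - r ^ 2)) *
        ((-x * Real.sqrt (1 - r ^ 2) + (u - r * x) * (r / Real.sqrt (1 - r ^ 2))) / (1 - r ^ 2)))
          - gphi u * x)) (Metric.ball_mem_nhds (0:ℝ) (by norm_num : (0:ℝ) < 1 / 2))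
    (Eventually.of_forall fun r => ((gg_meas u).mul (hkm r)).aestronglyMeasurable)
    (by simp [kk_zero]) ?_ ?_ hb ?_
  · have := key.2
    simpa using this
  · have := gphi_cont.measurable
    have := gg_meas u
    apply Measurable.aestronglyMeasurable
    fun_prop
  · refine ae_of_all _ fun x r hr => ?_
    have hr' : |r| < 1 / 2 := by simpa [Real.dist_eq] using hr
    rw [norm_mul, Real.norm_eq_abs, Real.norm_eq_abs]
    exact mul_le_mul_of_nonneg_left (kk_deriv_bound u r x hr') (abs_nonneg _)
  · refine ae_of_all _ fun x r hr => ?_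
    have hr' : |r| < 1 / 2 := by simpa [Real.dist_eq] using hr
    have hr2 : r ^ 2 < 1 := by have := abs_lt.1 hr'; nlinarith
    exact (kk_hasDeriv u r x hr2).const_mul _

lemma GG_zero (u : ℝ) : GG u 0 = 0 := by
  unfold GG
  simp_rw [inner_eq u 0 _ (by norm_num), kk_zero]
  simp

lemma GG_small (u ε : ℝ) (hε : 0 < ε) : ∃ η > 0, ∀ r, 0 ≤ r → r < η → |GG u r| ≤ ε * r := by
  have h := (GG_hasDeriv u).isLittleO
  have h2 := h.def hε
  rw [Metric.eventually_nhds_iff] at h2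
  obtain ⟨η, hη, h3⟩ := h2
  refine ⟨η, hη, fun r hr0 hr => ?_⟩
  have := h3 (y := r) (by rw [Real.dist_eq, sub_zero, abs_of_nonneg hr0]; exact hr)
  simpa [GG_zero, abs_of_nonneg hr0] using this

lemma map_lin_std (a b : ℝ) :
    ((gaussianReal 0 1).prod (gaussianReal 0 1)).map (fun p : ℝ × ℝ => a * p.1 + b * p.2)
      = gaussianReal 0 (Real.toNNReal (a ^ 2 + b ^ 2)) := by
  have hind : IndepFun (fun p : ℝ × ℝ => a * p.1) (fun p : ℝ × ℝ => b * p.2)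
      ((gaussianReal 0 1).prod (gaussianReal 0 1)) :=
    indepFun_prod (μ := gaussianReal 0 1) (ν := gaussianReal 0 1)
      (X := fun x : ℝ => a * x) (Y := fun x : ℝ => b * x) (by fun_prop) (by fun_prop)
  have h1 : ((gaussianReal 0 1).prod (gaussianReal 0 1)).map (fun p : ℝ × ℝ => a * p.1)
      = gaussianReal 0 (Real.toNNReal (a ^ 2)) := by
    have : (fun p : ℝ × ℝ => a * p.1) = (fun x => a * x) ∘ Prod.fst := rfl
    rw [this, ← Measure.map_map (by fun_prop) measurable_fst, Measure.map_fst_prod,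
      measure_univ, one_smul, gaussianReal_map_const_mul]
    congr 1
    · simp
    · rw [mul_one]; ext; simp [sq_nonneg]
  have h2 : ((gaussianReal 0 1).prod (gaussianReal 0 1)).map (fun p : ℝ × ℝ => b * p.2)
      = gaussianReal 0 (Real.toNNReal (b ^ 2)) := by
    have : (fun p : ℝ × ℝ => b * p.2) = (fun x => b * x) ∘ Prod.snd := rfl
    rw [this, ← Measure.map_map (by fun_prop) measurable_snd, Measure.map_snd_prod,
      measure_univ, one_smul, gaussianReal_map_const_mul]
    congr 1
    · simp
    · rw [mul_one]; ext; simp [sq_nonneg]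
  have h3 := gaussianReal_add_gaussianReal_of_indepFun hind h1 h2
  rw [Real.toNNReal_add (sq_nonneg _) (sq_nonneg _)]
  rw [add_zero] at h3
  exact h3

lemma joint_law {Ω : Type*} [MeasurableSpace Ω] (P : Measure Ω) [IsProbabilityMeasure P]
    (X Y : Ω → ℝ) (hX : Measurable X) (hY : Measurable Y) (r : ℝ) (hr : r ∈ Set.Icc (0:ℝ) 1)
    (h : ∀ a b : ℝ, P.map (fun ω => a * X ω + b * Y ω)
      = gaussianReal 0 (Real.toNNReal (a ^ 2 + 2 * a * b * r + b ^ 2))) :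
    P.map (fun ω => (X ω, Y ω)) =
      ((gaussianReal 0 1).prod (gaussianReal 0 1)).map
        (fun p : ℝ × ℝ => (p.1, r * p.1 + Real.sqrt (1 - r ^ 2) * p.2)) := by
  have : IsProbabilityMeasure (P.map (fun ω => (X ω, Y ω))) :=
    Measure.isProbabilityMeasure_map (by fun_prop)
  have : IsProbabilityMeasure (((gaussianReal 0 1).prod (gaussianReal 0 1)).map
        (fun p : ℝ × ℝ => (p.1, r * p.1 + Real.sqrt (1 - r ^ 2) * p.2))) :=
    Measure.isProbabilityMeasure_map (by fun_prop)
  refine Measure.ext_of_charFunDual ?_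
  ext L
  have hL : ∀ x y : ℝ, L (x, y) = L (1, 0) * x + L (0, 1) * y := by
    intro x y
    have : ((x, y) : ℝ × ℝ) = x • (1, 0) + y • (0, 1) := by ext <;> simp
    rw [this, map_add, map_smul, map_smul]
    simp [mul_comm]
  set a := L (1, 0)
  set b := L (0, 1)
  rw [charFunDual_eq_charFun_map_one, charFunDual_eq_charFun_map_one]
  congr 1
  rw [Measure.map_map (by fun_prop) (by fun_prop), Measure.map_map (by fun_prop) (by fun_prop)]
  have e1 : (L ∘ fun ω => (X ω, Y ω)) = fun ω => a * X ω + b * Y ω := by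
    funext ω; exact hL _ _
  have e2 : (L ∘ fun p : ℝ × ℝ => (p.1, r * p.1 + Real.sqrt (1 - r ^ 2) * p.2))
      = fun p => (a + b * r) * p.1 + (b * Real.sqrt (1 - r ^ 2)) * p.2 := by
    funext p
    simp only [Function.comp]
    rw [hL]; ring
  rw [e1, e2, h, map_lin_std]
  congr 2
  have hs : Real.sqrt (1 - r ^ 2) ^ 2 = 1 - r ^ 2 := Real.sq_sqrt (by nlinarith [hr.1, hr.2])
  rw [mul_pow, hs]
  ring

section field
set_option linter.unusedSectionVars false
variable {S : Type*} [MeasurableSpace S]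

/-- Abstract Gaussian family with covariance `ρ`. -/
structure GF (P : Measure Ω) (z : S → Ω → ℝ) (ρ : S → S → ℝ) : Prop where
  meas : Measurable fun p : S × Ω => z p.1 p.2
  gauss : ∀ (n : ℕ) (c : Fin n → ℝ) (x : Fin n → S),
    Measure.map (fun ω => ∑ i, c i * z (x i) ω) P
      = gaussianReal 0 (Real.toNNReal (∑ i, ∑ j, c i * c j * ρ (x i) (x j)))
  mem : ∀ p q, ρ p q ∈ Set.Icc (0:ℝ) 1
  diag : ∀ p, ρ p p = 1
  symm : ∀ p q, ρ p q = ρ q p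

variable {P : Measure Ω} [IsProbabilityMeasure P] {z : S → Ω → ℝ} {ρ : S → S → ℝ}

lemma GF.measz (h : GF P z ρ) (p : S) : Measurable (z p) :=
  h.meas.comp (measurable_const.prodMk measurable_id)

lemma GF.law (h : GF P z ρ) (p : S) : P.map (z p) = gaussianReal 0 1 := by
  have := h.gauss 1 (fun _ => 1) (fun _ => p)
  simpa [h.diag] using this

lemma GF.joint (h : GF P z ρ) (p q : S) : P.map (fun ω => (z p ω, z q ω)) =
      ((gaussianReal 0 1).prod (gaussianReal 0 1)).map
        (fun x : ℝ × ℝ => (x.1, ρ p q * x.1 + Real.sqrt (1 - ρ p q ^ 2) * x.2)) := by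
  refine joint_law P _ _ (h.measz p) (h.measz q) _ (h.mem p q) fun a b => ?_
  have := h.gauss 2 ![a, b] ![p, q]
  simp only [Fin.sum_univ_two, Matrix.cons_val_zero, Matrix.cons_val_one, h.diag, h.symm q p] at this
  rw [this]
  congr 2
  ring

lemma GF.memLp (h : GF P z ρ) {g : ℝ → ℝ} (hg : MemLp g 2 (gaussianReal 0 1)) (p : S) :
    MemLp (fun ω => g (z p ω)) 2 P := by
  rw [← h.law p] at hg
  exact hg.comp_of_map (h.measz p).aemeasurable

lemma GF.int_comp (h : GF P z ρ) {g : ℝ → ℝ} (hg : AEStronglyMeasurable g (gaussianReal 0 1)) (p : S) :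
    ∫ ω, g (z p ω) ∂P = ∫ x, g x ∂(gaussianReal 0 1) := by
  rw [← h.law p] at hg ⊢
  rw [integral_map (h.measz p).aemeasurable hg]

lemma GF.pair_int (h : GF P z ρ) {g : ℝ → ℝ} (hgm : Measurable g)
    (hg : MemLp g 2 (gaussianReal 0 1)) (p q : S) :
    Integrable (fun ω => g (z p ω) * g (z q ω)) P ∧
    ∫ ω, g (z p ω) * g (z q ω) ∂P = 
      ∫ x, g x * ∫ w, g (ρ p q * x + Real.sqrt (1 - ρ p q ^ 2) * w) ∂(gaussianReal 0 1)
        ∂(gaussianReal 0 1) := by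
  have hi : Integrable (fun ω => g (z p ω) * g (z q ω)) P :=
    (h.memLp hg p).integrable_mul (h.memLp hg q)
  refine ⟨hi, ?_⟩
  have hm := h.measz p
  have hm' := h.measz q
  have hF : Measurable (fun y : ℝ × ℝ => g y.1 * g y.2) := by fun_prop
  have e1 : ∫ ω, g (z p ω) * g (z q ω) ∂P
      = ∫ y, g y.1 * g y.2 ∂(P.map (fun ω => (z p ω, z q ω))) := by
    rw [integral_map (by fun_prop) hF.aestronglyMeasurable]
  have hi2 : Integrable (fun y : ℝ × ℝ => g y.1 * g y.2) (P.map (fun ω => (z p ω, z q ω))) := by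
    rw [integrable_map_measure hF.aestronglyMeasurable (by fun_prop)]
    exact hi
  rw [e1]
  rw [h.joint p q] at hi2 ⊢
  rw [integrable_map_measure hF.aestronglyMeasurable (by fun_prop)] at hi2
  rw [integral_map (by fun_prop) hF.aestronglyMeasurable]
  refine (integral_prod _ hi2).trans ?_
  simp only [integral_const_mul, Function.comp]

lemma GF.cov (h : GF P z ρ) (p q : S) : ∫ ω, z p ω * z q ω ∂P = ρ p q := by
  have := (h.pair_int (g := fun x => x) measurable_id id_memLp p q).2
  rw [this]
  have hid : Integrable (fun w : ℝ => w) (gaussianReal 0 1) := id_memLp.integrable (by norm_num)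
  have e : ∀ x : ℝ, ∫ w, (ρ p q * x + Real.sqrt (1 - ρ p q ^ 2) * w) ∂(gaussianReal 0 1)
      = ρ p q * x := by
    intro x
    rw [integral_add (integrable_const _) (hid.const_mul _), integral_const_mul (Real.sqrt _),
      integral_id_gaussianReal]
    simp
  simp_rw [e]
  have h2 : ∫ x : ℝ, x * x ∂(gaussianReal 0 1) = 1 := by
    have hv := variance_fun_id_gaussianReal (μ := 0) (v := 1)
    rw [variance_eq_integral (by fun_prop)] at hv
    simp only [integral_id_gaussianReal, sub_zero] at hv
    simpa [sq] using hv
  have : (fun x : ℝ => x * (ρ p q * x)) = fun x => ρ p q * (x * x) := by funext x; ring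
  rw [this, integral_const_mul, h2, mul_one]

lemma GF.covg (h : GF P z ρ) (u : ℝ) (p q : S) :
    ∫ ω, gg u (z p ω) * gg u (z q ω) ∂P = GG u (ρ p q) :=
  (h.pair_int (gg_meas u) (gg_memLp u) p q).2

lemma GF.abs_pair (h : GF P z ρ) {g : ℝ → ℝ} (hg : MemLp g 2 (gaussianReal 0 1)) (p q : S) :
    ∫ ω, |g (z p ω) * g (z q ω)| ∂P ≤ ∫ x, g x ^ 2 ∂(gaussianReal 0 1) := by
  have hi : Integrable (fun ω => g (z p ω) * g (z q ω)) P :=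
    (h.memLp hg p).integrable_mul (h.memLp hg q)
  have h1 := (h.memLp hg p).integrable_sq
  have h2 := (h.memLp hg q).integrable_sq
  have hsm : AEStronglyMeasurable (fun x => g x ^ 2) (gaussianReal 0 1) :=
    hg.integrable_sq.aestronglyMeasurable
  calc ∫ ω, |g (z p ω) * g (z q ω)| ∂P ≤ ∫ ω, (g (z p ω) ^ 2 * (1/2) + g (z q ω) ^ 2 * (1/2)) ∂P := by
        refine integral_mono hi.abs ((h1.mul_const _).add (h2.mul_const _)) fun ω => ?_
        simp only
        rw [abs_mul, ← sq_abs (g (z p ω)), ← sq_abs (g (z q ω))]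
        nlinarith [sq_nonneg (|g (z p ω)| - |g (z q ω)|)]
    _ = _ := by
        rw [integral_add (h1.mul_const _) (h2.mul_const _), integral_mul_const, integral_mul_const,
          h.int_comp hsm p, h.int_comp hsm q]
        ring

variable {μ : Measure S} [IsFiniteMeasure μ]

lemma GF.memLp_prod (h : GF P z ρ) {g : ℝ → ℝ} (hgm : Measurable g)
    (hg : MemLp g 2 (gaussianReal 0 1)) :
    MemLp (fun t : S × Ω => g (z t.1 t.2)) 2 (μ.prod P) := by
  have hm := h.meas
  have hm2 : Measurable (fun t : S × Ω => g (z t.1 t.2)) := hgm.comp hm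
  rw [memLp_two_iff_integrable_sq hm2.aestronglyMeasurable,
    integrable_prod_iff (hm2.pow_const 2).aestronglyMeasurable]
  refine ⟨ae_of_all _ fun p => (h.memLp hg p).integrable_sq, ?_⟩
  have : (fun p => ∫ ω, ‖g (z p ω) ^ 2‖ ∂P) = fun _ => ∫ x, g x ^ 2 ∂(gaussianReal 0 1) := by
    funext p
    simp only [norm_pow, Real.norm_eq_abs, sq_abs]
    exact h.int_comp (hg.integrable_sq.aestronglyMeasurable) p
  simp only [this]
  exact integrable_const _

lemma GF.int3 (h : GF P z ρ) {g : ℝ → ℝ} (hgm : Measurable g)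
    (hg : MemLp g 2 (gaussianReal 0 1)) :
    Integrable (fun t : (S × S) × Ω => g (z t.1.1 t.2) * g (z t.1.2 t.2)) ((μ.prod μ).prod P) := by
  have hm := h.meas
  have h1 : Measurable (fun t : (S × S) × Ω => g (z t.1.1 t.2)) :=
    hgm.comp (hm.comp ((measurable_fst.comp measurable_fst).prodMk measurable_snd))
  have h2 : Measurable (fun t : (S × S) × Ω => g (z t.1.2 t.2)) :=
    hgm.comp (hm.comp ((measurable_snd.comp measurable_fst).prodMk measurable_snd))
  have h12 : Measurable (fun t : (S × S) × Ω => g (z t.1.1 t.2) * g (z t.1.2 t.2)) := h1.mul h2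
  rw [integrable_prod_iff h12.aestronglyMeasurable]
  refine ⟨ae_of_all _ fun p => (h.pair_int hgm hg p.1 p.2).1, ?_⟩
  refine Integrable.of_bound (C := ∫ x, g x ^ 2 ∂(gaussianReal 0 1)) ?_ (ae_of_all _ fun p => ?_)
  · exact (h12.norm.stronglyMeasurable.integral_prod_right (ν := P)).aestronglyMeasurable
  · rw [Real.norm_of_nonneg (integral_nonneg fun _ => norm_nonneg _)]
    exact h.abs_pair hg p.1 p.2

lemma GF.sq_int (h : GF P z ρ) {g : ℝ → ℝ} (hgm : Measurable g)
    (hg : MemLp g 2 (gaussianReal 0 1)) :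
    MemLp (fun ω => ∫ p, g (z p ω) ∂μ) 2 P ∧
    ∫ ω, (∫ p, g (z p ω) ∂μ) ^ 2 ∂P =
      ∫ pq, (∫ ω, g (z pq.1 ω) * g (z pq.2 ω) ∂P) ∂(μ.prod μ) := by
  have h3 := h.int3 (μ := μ) hgm hg
  have hsq : ∀ ω, (∫ p, g (z p ω) ∂μ) ^ 2 = ∫ pq, g (z pq.1 ω) * g (z pq.2 ω) ∂(μ.prod μ) := by
    intro ω
    rw [sq, ← integral_prod_mul (fun p => g (z p ω)) (fun p => g (z p ω))]
  constructor
  · have hm : Measurable (fun t : S × Ω => g (z t.1 t.2)) := hgm.comp h.meas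
    rw [memLp_two_iff_integrable_sq (hm.stronglyMeasurable.integral_prod_left').aestronglyMeasurable]
    simp_rw [hsq]
    exact h3.integral_prod_right
  · simp_rw [hsq]
    rw [integral_integral_swap]
    exact h3.swap

lemma gauss_sq {X : Ω → ℝ} (hX : AEMeasurable X P) {v : NNReal} (h : P.map X = gaussianReal 0 v) :
    ∫ ω, X ω * X ω ∂P = v := by
  have hv := variance_fun_id_gaussianReal (μ := 0) (v := v)
  rw [variance_eq_integral (by fun_prop)] at hv
  simp only [integral_id_gaussianReal, sub_zero] at hv
  rw [← h, integral_map hX (by fun_prop)] at hv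
  simpa [sq] using hv

lemma gauss_char {X : Ω → ℝ} (hX : AEMeasurable X P) {v : NNReal} (h : P.map X = gaussianReal 0 v)
    (s : ℝ) :
    ∫ ω, Complex.exp (s * X ω * Complex.I) ∂P = Complex.exp (-(s ^ 2 * v / 2)) := by
  have h1 := charFun_gaussianReal (μ := 0) (v := v) s
  rw [← h, charFun_apply_real, integral_map hX (by fun_prop)] at h1
  rw [h1]
  congr 1
  simp
  ring

lemma l2_norm_sq (f : Lp ℝ 2 P) : ‖f‖ ^ 2 = ∫ ω, f ω * f ω ∂P := by
  rw [← real_inner_self_eq_norm_sq, L2.inner_def]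
  simp [sq]

lemma l2_int_abs_le (f : Lp ℝ 2 P) : ∫ ω, |f ω| ∂P ≤ ‖f‖ := by
  have h1 : MemLp (fun ω => |f ω|) 2 P := (Lp.memLp f).norm
  have hv := variance_nonneg (fun ω => |f ω|) P
  rw [variance_eq_sub h1] at hv
  have h2 : ∫ ω, |f ω| ^ 2 ∂P = ‖f‖ ^ 2 := by
    rw [l2_norm_sq]; simp [sq]
  have h3 : P[(fun ω => |f ω|) ^ 2] = ‖f‖ ^ 2 := h2
  rw [h3] at hv
  exact abs_le_of_sq_le_sq (by linarith) (norm_nonneg _) |> (le_abs_self _).trans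

lemma exp_diff (a b : ℝ) : ‖Complex.exp (a * Complex.I) - Complex.exp (b * Complex.I)‖ ≤ |a - b| := by
  have h1 : Complex.exp (a * Complex.I) - Complex.exp (b * Complex.I)
      = Complex.exp (b * Complex.I) * (Complex.exp (Complex.I * ((a - b : ℝ) : ℂ)) - 1) := by
    rw [mul_sub, ← Complex.exp_add, mul_one]
    congr 2
    push_cast; ring
  rw [h1, norm_mul, Complex.norm_exp_ofReal_mul_I, one_mul]
  exact Real.norm_exp_I_mul_ofReal_sub_one_le

lemma char_lip (s : ℝ) : Continuous fun f : Lp ℝ 2 P => ∫ ω, Complex.exp (s * f ω * Complex.I) ∂P := by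
  have hIntExp : ∀ f : Lp ℝ 2 P, Integrable (fun ω => Complex.exp (s * f ω * Complex.I)) P := by
    intro f
    have hf := (Lp.aestronglyMeasurable f)
    refine Integrable.of_bound (C := 1) ?_ (ae_of_all _ fun ω => ?_)
    · have : Continuous fun x : ℝ => Complex.exp (s * x * Complex.I) := by fun_prop
      exact this.comp_aestronglyMeasurable hf
    · rw [← Complex.ofReal_mul, Complex.norm_exp_ofReal_mul_I]
  refine (LipschitzWith.of_dist_le_mul (K := ‖s‖₊) fun f g => ?_).continuous
  rw [dist_eq_norm, ← integral_sub (hIntExp f) (hIntExp g), dist_eq_norm]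
  refine (norm_integral_le_integral_norm _).trans ?_
  have hb : ∫ ω, |s| * |(f - g) ω| ∂P ≤ ‖s‖₊ * ‖f - g‖ := by
    rw [integral_const_mul]
    exact mul_le_mul_of_nonneg_left (l2_int_abs_le _) (abs_nonneg _)
  refine le_trans (integral_mono_ae ((hIntExp f).sub (hIntExp g)).norm ?_ ?_) hb
  · exact (((Lp.memLp (f - g)).integrable (by norm_num)).norm).const_mul _
  · filter_upwards [Lp.coeFn_sub f g] with ω hω
    rw [hω, Pi.sub_apply, ← abs_mul, mul_sub]
    have := exp_diff (s * f ω) (s * g ω)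
    push_cast at this
    exact this

lemma GF.law_int (h : GF P z ρ) :
    P.map (fun ω => ∫ p, z p ω ∂μ) =
      gaussianReal 0 (Real.toNNReal (∫ pq, ρ pq.1 pq.2 ∂(μ.prod μ))) := by
  have hLp : ∀ p, MemLp (z p) 2 P := fun p => h.memLp (g := fun x => x) id_memLp p
  obtain ⟨hL, hL2⟩ := h.sq_int (μ := μ) (g := fun x => x) measurable_id id_memLp
  simp only [h.cov] at hL2
  set V : Submodule ℝ (Lp ℝ 2 P) := Submodule.span ℝ (Set.range fun p => (hLp p).toLp) with hV
  set A : Set (Lp ℝ 2 P) := {f | ∀ s : ℝ, ∫ ω, Complex.exp (s * f ω * Complex.I) ∂P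
    = Complex.exp (-(s ^ 2 * (‖f‖ ^ 2 : ℝ) / 2))} with hA
  have hAc : IsClosed A := by
    rw [hA, Set.ofPred_forall]
    refine isClosed_iInter fun s => isClosed_eq (char_lip s) (by fun_prop)
  have hVA : (V : Set (Lp ℝ 2 P)) ⊆ A := by
    intro f hf s
    obtain ⟨n, c, y, rfl⟩ := Submodule.mem_span_set'.1 hf
    choose p hp using fun i => (y i).2
    have hae : (∑ i, c i • (y i : Lp ℝ 2 P) : Lp ℝ 2 P) =ᵐ[P] fun ω => ∑ i, c i * z (p i) ω := by
      have h1 : ∀ i, ((c i • (y i : Lp ℝ 2 P) : Lp ℝ 2 P) : Ω → ℝ) =ᵐ[P] fun ω => c i * z (p i) ω := by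
        intro i
        rw [← hp i]
        filter_upwards [Lp.coeFn_smul (c i) (hLp (p i)).toLp, (hLp (p i)).coeFn_toLp] with ω h1 h2
        rw [h1, Pi.smul_apply, h2, smul_eq_mul]
      refine (Lp.coeFn_finsetSum _ _).trans ?_
      filter_upwards [ae_all_iff.2 h1] with ω hω
      simp [hω]
    have hlaw := h.gauss n c p
    rw [← Measure.map_congr hae] at hlaw
    have hme := (Lp.aestronglyMeasurable (∑ i, c i • (y i : Lp ℝ 2 P) : Lp ℝ 2 P)).aemeasurable
    rw [gauss_char hme hlaw s, l2_norm_sq, gauss_sq hme hlaw]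
  set LL : Lp ℝ 2 P := hL.toLp _ with hLLdef
  have hLL : LL =ᵐ[P] fun ω => ∫ p, z p ω ∂μ := hL.coeFn_toLp
  have hLV : LL ∈ V.topologicalClosure := by
    rw [← Submodule.orthogonal_orthogonal_eq_closure, Submodule.mem_orthogonal]
    intro f hf
    rw [Submodule.mem_orthogonal] at hf
    have hf0 : ∀ p, ∫ ω, z p ω * f ω ∂P = 0 := by
      intro p
      have h1 := hf _ (Submodule.subset_span ⟨p, rfl⟩)
      rw [L2.inner_def] at h1
      rw [← h1]
      refine integral_congr_ae ?_
      filter_upwards [(hLp p).coeFn_toLp] with ω hω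
      simp [hω, mul_comm]
    rw [L2.inner_def]
    have e1 : ∫ ω, inner ℝ (f ω) (LL ω) ∂P = ∫ ω, ∫ p, z p ω * f ω ∂μ ∂P := by
      refine integral_congr_ae ?_
      filter_upwards [hLL] with ω hω
      rw [hω, integral_mul_const]
      simp
    rw [e1, integral_integral_swap]
    · simp [hf0]
    · have hz := h.memLp_prod (μ := μ) (g := fun x => x) measurable_id id_memLp
      have hf2 : MemLp (fun t : S × Ω => f t.2) 2 (μ.prod P) := (Lp.memLp f).comp_snd μ
      exact (hz.integrable_mul hf2).swap
  have hLA : LL ∈ A := closure_minimal hVA hAc hLV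
  have hmeas := hL.aestronglyMeasurable.aemeasurable
  have := Measure.isProbabilityMeasure_map hmeas
  refine Measure.ext_of_charFun ?_
  ext s
  rw [charFun_apply_real, integral_map hmeas (by fun_prop), charFun_gaussianReal]
  have h5 := hLA s
  have h6 : ∫ ω, Complex.exp (s * LL ω * Complex.I) ∂P
      = ∫ ω, Complex.exp (s * (∫ p, z p ω ∂μ : ℝ) * Complex.I) ∂P := by
    refine integral_congr_ae ?_
    filter_upwards [hLL] with ω hω
    rw [hω]
  rw [← h6, h5, l2_norm_sq]
  have h7 : ∫ ω, LL ω * LL ω ∂P = ∫ pq, ρ pq.1 pq.2 ∂(μ.prod μ) := by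
    rw [← hL2]
    refine integral_congr_ae ?_
    filter_upwards [hLL] with ω hω
    rw [hω, sq]
  rw [h7, Real.coe_toNNReal _ (integral_nonneg fun pq => (h.mem _ _).1)]
  congr 1
  push_cast
  ring

end field

lemma slutsky_final {Ω : Type*} [MeasurableSpace Ω] (P : Measure Ω) [IsProbabilityMeasure P]
    (X Y R : ℝ → Ω → ℝ) (hX : ∀ T, AEMeasurable (X T) P) (hY : ∀ T, AEMeasurable (Y T) P)
    (hR : ∀ T, MemLp (R T) 2 P)
    (hlaw : ∀ᶠ T in atTop, P.map (X T) = gaussianReal 0 1)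
    (hYX : ∀ᶠ T in atTop, ∀ᵐ ω ∂P, R T ω = Y T ω - X T ω)
    (hR0 : Tendsto (fun T => ∫ ω, (R T ω) ^ 2 ∂P) atTop (nhds 0)) (f : ℝ →ᵇ ℝ) :
    Tendsto (fun T => ∫ ω, f (Y T ω) ∂P) atTop (nhds (∫ x, f x ∂(gaussianReal 0 1))) := by
  have h1 : TendstoInDistribution X atTop (fun x : ℝ => x) (fun _ => P) (gaussianReal 0 1) := by
    refine ⟨hX, by fun_prop, ?_⟩
    refine tendsto_const_nhds.congr' ?_
    filter_upwards [hlaw] with T hT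
    ext1
    simp [hT]
  have h2 : TendstoInMeasure P R atTop 0 := by
    rw [tendstoInMeasure_iff_measureReal_norm]
    intro ε hε
    have h3 : Tendsto (fun T => (∫ ω, (R T ω) ^ 2 ∂P) / ε ^ 2) atTop (nhds 0) := by
      simpa using hR0.div_const (ε ^ 2)
    refine squeeze_zero (fun _ => measureReal_nonneg) (fun T => ?_) h3
    have h4 := mul_meas_ge_le_integral_of_nonneg (μ := P) (f := fun ω => R T ω ^ 2)
      (ae_of_all _ fun ω => sq_nonneg _) (hR T).integrable_sq (ε ^ 2)
    rw [le_div_iff₀ (by positivity), mul_comm]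
    refine le_trans (mul_le_mul_of_nonneg_left (measureReal_mono ?_) (by positivity)) h4
    intro ω hω
    simp only [Set.mem_ofPred_eq, Pi.zero_apply, sub_zero, Real.norm_eq_abs] at hω ⊢
    rw [← sq_abs (R T ω)]
    exact pow_le_pow_left₀ hε.le hω 2
  have h3 : TendstoInMeasure P (Y - X) atTop 0 := by
    refine TendstoInMeasure.congr' ?_ (EventuallyEq.refl _ _) h2
    filter_upwards [hYX] with T hT
    filter_upwards [hT] with ω hω
    simpa using hω
  have h4 := tendstoInDistribution_of_tendstoInMeasure_sub Y _ h1 h3 hY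
  have h5 := (ProbabilityMeasure.tendsto_iff_forall_integral_tendsto.1 h4.tendsto) f
  simp only [ProbabilityMeasure.coe_mk] at h5
  have h6 : Measure.map (fun x : ℝ => x) (gaussianReal 0 1) = gaussianReal 0 1 := Measure.map_id
  rw [h6] at h5
  refine h5.congr fun T => ?_
  rw [integral_map (hY T) (by fun_prop)]

lemma time_int (h : ℝ → ℝ) (hh : Continuous h) (T : ℝ) (hT : 0 ≤ T) :
    ∫ t in (0:ℝ)..T, ∫ s in (0:ℝ)..T, h |t - s| = 2 * ∫ τ in (0:ℝ)..T, (T - τ) * h τ := by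
  set G : ℝ → ℝ := fun t => ∫ s in (0:ℝ)..t, h s with hG
  have hGd : ∀ t, HasDerivAt G (h t) t := fun t =>
    intervalIntegral.integral_hasDerivAt_right (hh.intervalIntegrable _ _)
      (hh.stronglyMeasurableAtFilter _ _) hh.continuousAt
  have hGc : Continuous G := continuous_iff_continuousAt.2 fun t => (hGd t).continuousAt
  have e1 : ∀ t ∈ Set.uIcc 0 T, ∫ s in (0:ℝ)..T, h |t - s| = G t + G (T - t) := by
    intro t ht
    rw [Set.uIcc_of_le hT] at ht
    have hc : Continuous fun s => h |t - s| := by fun_prop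
    rw [← intervalIntegral.integral_add_adjacent_intervals (b := t) (hc.intervalIntegrable _ _)
      (hc.intervalIntegrable _ _)]
    congr 1
    · have : ∫ s in (0:ℝ)..t, h |t - s| = ∫ s in (0:ℝ)..t, h (t - s) := by
        refine intervalIntegral.integral_congr fun s hs => ?_
        rw [Set.uIcc_of_le ht.1] at hs
        rw [abs_of_nonneg (by linarith [hs.2])]
      rw [this, intervalIntegral.integral_comp_sub_left (fun s => h s)]
      simp [hG]
    · have : ∫ s in t..T, h |t - s| = ∫ s in t..T, h (s - t) := by
        refine intervalIntegral.integral_congr fun s hs => ?_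
        rw [Set.uIcc_of_le ht.2] at hs
        rw [abs_of_nonpos (by linarith [hs.1]), neg_sub]
      rw [this, intervalIntegral.integral_comp_sub_right (fun s => h s)]
      simp [hG]
  rw [intervalIntegral.integral_congr e1, intervalIntegral.integral_add
    (hGc.intervalIntegrable _ _) ((by fun_prop : Continuous fun t => G (T - t)).intervalIntegrable _ _),
    intervalIntegral.integral_comp_sub_left (fun s => G s)]
  have e2 := intervalIntegral.integral_mul_deriv_eq_deriv_mul (a := 0) (b := T)
    (u := fun t => T - t) (v := G) (u' := fun _ => -1) (v' := h)
    (fun x _ => by simpa using (hasDerivAt_id x).const_sub T) (fun x _ => hGd x)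
    (by simp) (hh.intervalIntegrable _ _)
  rw [e2]
  have hG0 : G 0 = 0 := by simp [hG]
  simp [hG0]
  ring

section concrete
variable {d : ℕ}

/-- The space-time window measure. -/
noncomputable def win (B : Set (EuclideanSpace ℝ (Fin d))) (T : ℝ) :
    Measure (ℝ × EuclideanSpace ℝ (Fin d)) :=
  (volume.restrict (Set.Ioc 0 T)).prod (volume.restrict B)

lemma field_GF (P : Measure Ω) [IsProbabilityMeasure P]
    (Z : EuclideanSpace ℝ (Fin d) → ℝ → Ω → ℝ) (C : ℝ → ℝ → ℝ)
    (hZmeas : Measurable fun p : (EuclideanSpace ℝ (Fin d) × ℝ) × Ω => Z p.1.1 p.1.2 p.2)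
    (hZgauss : IsGaussianField P Z C)
    (hC01 : ∀ z τ : ℝ, C z τ ∈ Set.Icc (0:ℝ) 1) (hCunit : C 0 0 = 1) :
    GF P (fun (p : ℝ × EuclideanSpace ℝ (Fin d)) ω => Z p.2 p.1 ω)
      (fun p q => C ‖p.2 - q.2‖ |p.1 - q.1|) where
  meas := hZmeas.comp (g := fun p : (EuclideanSpace ℝ (Fin d) × ℝ) × Ω => Z p.1.1 p.1.2 p.2)
    (f := fun p : (ℝ × EuclideanSpace ℝ (Fin d)) × Ω => ((p.1.2, p.1.1), p.2)) (by fun_prop)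
  gauss := fun n c x => hZgauss n c (fun i => (x i).2) (fun i => (x i).1)
  mem := fun p q => hC01 _ _
  diag := fun p => by simp [hCunit]
  symm := fun p q => by rw [norm_sub_rev, abs_sub_comm]

lemma cov_int (C : ℝ → ℝ → ℝ) (hC01 : ∀ z τ : ℝ, C z τ ∈ Set.Icc (0:ℝ) 1)
    (hCcont : Continuous fun p : ℝ × ℝ => C p.1 p.2)
    (B : Set (EuclideanSpace ℝ (Fin d))) (hB : volume B < ⊤) (T : ℝ) (hT : 0 ≤ T) :
    ∫ pq, C ‖pq.1.2 - pq.2.2‖ |pq.1.1 - pq.2.1| ∂((win B T).prod (win B T))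
      = 2 * ∫ τ in (0:ℝ)..T, (T - τ) * ∫ x in B, ∫ y in B, C ‖x - y‖ τ := by
  have hfin : IsFiniteMeasure (volume.restrict B) := ⟨by simpa using hB⟩
  have hfin2 : IsFiniteMeasure (win B T) := by unfold win; infer_instance
  have hbd : ∀ z τ, ‖C z τ‖ ≤ 1 := fun z τ => by
    rw [Real.norm_of_nonneg (hC01 z τ).1]; exact (hC01 z τ).2
  set h : ℝ → ℝ := fun τ => ∫ x in B, ∫ y in B, C ‖x - y‖ τ with hh
  have hcC : ∀ {α : Type} [TopologicalSpace α] (a b : α → ℝ), Continuous a → Continuous b →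
      Continuous fun v => C (a v) (b v) := fun a b ha hb => hCcont.comp (ha.prodMk hb)
  have hhprod : ∀ τ, h τ = ∫ xy, C ‖xy.1 - xy.2‖ τ ∂((volume.restrict B).prod (volume.restrict B)) := by
    intro τ
    rw [integral_prod]
    have hc : Continuous fun xy : EuclideanSpace ℝ (Fin d) × EuclideanSpace ℝ (Fin d) =>
      C ‖xy.1 - xy.2‖ τ := hcC _ _ (by fun_prop) (by fun_prop)
    exact Integrable.of_bound hc.aestronglyMeasurable 1 (ae_of_all _ fun _ => hbd _ _)
  have hhc : Continuous h := by
    rw [funext hhprod]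
    refine continuous_of_dominated (bound := fun _ => 1) (fun τ => ?_)
      (fun τ => ae_of_all _ fun _ => hbd _ _) (integrable_const _) (ae_of_all _ fun xy => ?_)
    · have hc : Continuous fun xy : EuclideanSpace ℝ (Fin d) × EuclideanSpace ℝ (Fin d) =>
        C ‖xy.1 - xy.2‖ τ := hcC _ _ (by fun_prop) (by fun_prop)
      exact hc.aestronglyMeasurable
    · exact hcC _ _ (by fun_prop) (by fun_prop)
  rw [← time_int h hhc T hT]
  have hc1 : Continuous fun pq : (ℝ × EuclideanSpace ℝ (Fin d)) × (ℝ × EuclideanSpace ℝ (Fin d)) =>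
      C ‖pq.1.2 - pq.2.2‖ |pq.1.1 - pq.2.1| := hcC _ _ (by fun_prop) (by fun_prop)
  have hi1 : Integrable (fun pq : (ℝ × EuclideanSpace ℝ (Fin d)) × (ℝ × EuclideanSpace ℝ (Fin d)) =>
      C ‖pq.1.2 - pq.2.2‖ |pq.1.1 - pq.2.1|) ((win B T).prod (win B T)) :=
    Integrable.of_bound hc1.aestronglyMeasurable 1 (ae_of_all _ fun _ => hbd _ _)
  rw [integral_prod _ hi1]
  have hi2 := hi1.integral_prod_left
  have e1 := integral_prod (μ := volume.restrict (Set.Ioc 0 T)) (ν := volume.restrict B) _ hi2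
  refine e1.trans ?_
  rw [intervalIntegral.integral_of_le hT]
  refine integral_congr_ae (ae_of_all _ fun t => ?_)
  simp only
  rw [intervalIntegral.integral_of_le hT]
  have hi3 : ∀ x : EuclideanSpace ℝ (Fin d), Integrable
      (fun q : ℝ × EuclideanSpace ℝ (Fin d) => C ‖x - q.2‖ |t - q.1|)
      ((volume.restrict (Set.Ioc 0 T)).prod (volume.restrict B)) := by
    intro x
    have hc : Continuous (fun q : ℝ × EuclideanSpace ℝ (Fin d) => C ‖x - q.2‖ |t - q.1|) :=
      hcC _ _ (by fun_prop) (by fun_prop)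
    exact Integrable.of_bound hc.aestronglyMeasurable 1 (ae_of_all _ fun _ => hbd _ _)
  have e2 : ∀ x : EuclideanSpace ℝ (Fin d),
      ∫ q, C ‖x - q.2‖ |t - q.1| ∂(win B T)
        = ∫ s in Set.Ioc 0 T, ∫ y in B, C ‖x - y‖ |t - s| := fun x => integral_prod _ (hi3 x)
  simp_rw [e2]
  rw [integral_integral_swap]
  have hi4 : Integrable (fun q : (EuclideanSpace ℝ (Fin d) × ℝ) × EuclideanSpace ℝ (Fin d) =>
      C ‖q.1.1 - q.2‖ |t - q.1.2|)
      (((volume.restrict B).prod (volume.restrict (Set.Ioc 0 T))).prod (volume.restrict B)) := by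
    have hc : Continuous (fun q : (EuclideanSpace ℝ (Fin d) × ℝ) × EuclideanSpace ℝ (Fin d) =>
      C ‖q.1.1 - q.2‖ |t - q.1.2|) :=
      hcC _ _ (by fun_prop) (by fun_prop)
    exact Integrable.of_bound hc.aestronglyMeasurable 1 (ae_of_all _ fun _ => hbd _ _)
  exact hi4.integral_prod_left

lemma near_meas (B : Set (EuclideanSpace ℝ (Fin d))) (hB : volume B < ⊤) (T N : ℝ) :
    ((win B T).prod (win B T)).real {pq | ‖pq.1.2 - pq.2.2‖ < N ∧ |pq.1.1 - pq.2.1| < N}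
      ≤ (volume.real (Metric.ball (0:ℝ) N) *
          volume.real (Metric.ball (0 : EuclideanSpace ℝ (Fin d)) N)) * (win B T).real Set.univ := by
  have hfin : IsFiniteMeasure (volume.restrict B) := ⟨by simpa using hB⟩
  have hfin2 : IsFiniteMeasure (win B T) := by unfold win; infer_instance
  have hms : MeasurableSet {pq : (ℝ × EuclideanSpace ℝ (Fin d)) × (ℝ × EuclideanSpace ℝ (Fin d)) |
      ‖pq.1.2 - pq.2.2‖ < N ∧ |pq.1.1 - pq.2.1| < N} := by
    apply MeasurableSet.inter
    · exact (isOpen_lt (f := fun pq : (ℝ × EuclideanSpace ℝ (Fin d)) × (ℝ × EuclideanSpace ℝ (Fin d))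
        => ‖pq.1.2 - pq.2.2‖) (by fun_prop) continuous_const).measurableSet
    · exact (isOpen_lt (f := fun pq : (ℝ × EuclideanSpace ℝ (Fin d)) × (ℝ × EuclideanSpace ℝ (Fin d))
        => |pq.1.1 - pq.2.1|) (by fun_prop) continuous_const).measurableSet
  have hle : ((win B T).prod (win B T)) {pq | ‖pq.1.2 - pq.2.2‖ < N ∧ |pq.1.1 - pq.2.1| < N}
      ≤ (volume (Metric.ball (0:ℝ) N) *
          volume (Metric.ball (0 : EuclideanSpace ℝ (Fin d)) N)) * (win B T) Set.univ := by
    rw [Measure.prod_apply hms]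
    refine (lintegral_mono (g := fun _ => (volume (Metric.ball (0:ℝ) N) *
          volume (Metric.ball (0 : EuclideanSpace ℝ (Fin d)) N))) fun p => ?_).trans ?_
    · simp only
      have hw : win B T ≤ volume.prod volume := by
        unfold win
        rw [Measure.prod_restrict]
        exact Measure.restrict_le_self
      refine (hw _).trans ?_
      rw [← Measure.addHaar_ball_center volume p.1 N, ← Measure.addHaar_ball_center volume p.2 N,
        ← Measure.prod_prod]
      refine measure_mono fun q hq => ?_
      simp only [Set.mem_preimage, Set.mem_ofPred_eq] at hq
      refine ⟨?_, ?_⟩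
      · rw [Metric.mem_ball, dist_comm, Real.dist_eq]; exact hq.2
      · rw [Metric.mem_ball, dist_comm, dist_eq_norm]; exact hq.1
    · rw [lintegral_const]
  have := ENNReal.toReal_mono (ENNReal.mul_ne_top (ENNReal.mul_ne_top measure_ball_lt_top.ne
    measure_ball_lt_top.ne) (measure_ne_top _ _)) hle
  rwa [ENNReal.toReal_mul, ENNReal.toReal_mul] at this

end concrete

theorem stmt18 (d : ℕ) (hd : 2 ≤ d) (P : Measure Ω) [IsProbabilityMeasure P]
    (Z : EuclideanSpace ℝ (Fin d) → ℝ → Ω → ℝ) (C : ℝ → ℝ → ℝ)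
    (hZmeas : Measurable fun p : (EuclideanSpace ℝ (Fin d) × ℝ) × Ω => Z p.1.1 p.1.2 p.2)
    (hZgauss : IsGaussianField P Z C)
    (hC01 : ∀ z τ : ℝ, C z τ ∈ Set.Icc (0:ℝ) 1) (hCunit : C 0 0 = 1)
    (hCcont : Continuous fun p : ℝ × ℝ => C p.1 p.2)
    (K : Set (EuclideanSpace ℝ (Fin d))) (hKconv : Convex ℝ K) (hKcomp : IsCompact K)
    (hKint : (0 : EuclideanSpace ℝ (Fin d)) ∈ interior K)
    (γ : ℝ) (hγ : 0 ≤ γ)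
    -- condition (i): the covariance vanishes at infinity
    (hCdecay : ∀ ε : ℝ, 0 < ε → ∃ N : ℝ, ∀ z τ : ℝ, 0 ≤ z → 0 ≤ τ →
      N ≤ max z τ → C z τ < ε)
    (σ1sq : ℝ → ℝ)
    (hσ1sq : ∀ T : ℝ, 0 < T → σ1sq T =
      2 * T * ((volume K).toReal) ^ 2 * T ^ (2 * γ * d) *
        ∫ τ in (0:ℝ)..T, (1 - τ / T) *
          ((((volume ((T ^ γ) • K)).toReal) ^ 2)⁻¹ *
            ∫ x in (T ^ γ) • K, ∫ y in (T ^ γ) • K, C ‖x - y‖ τ))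
    -- condition (ii): LRD in space and time
    (δ₁ δ₂ : ℝ) (hδ₁ : δ₁ ∈ Set.Ioo (0:ℝ) 1) (hδ₂ : δ₂ ∈ Set.Ioo (0:ℝ) 1)
    (hLRD : Tendsto (fun T : ℝ => σ1sq T / (T ^ (1 + δ₁) * T ^ (γ * d * (1 + δ₂))))
      atTop atTop)
    (u : ℝ) (M : ℝ → Ω → ℝ)
    (hM : ∀ T : ℝ, 0 < T → ∀ ω, M T ω = ∫ t in (0:ℝ)..T, ∫ x in (T ^ γ) • K,
      Set.indicator (Set.Ici u) (fun _ => (1:ℝ)) (Z x t ω)) :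
    ∀ f : ℝ →ᵇ ℝ,
      Tendsto (fun T : ℝ => ∫ ω, f ((M T ω -
          (1 - gPhi u) * (volume K).toReal * T ^ (1 + γ * d)) /
            (gphi u * Real.sqrt (σ1sq T))) ∂P)
        atTop (nhds (∫ x, f x ∂(gaussianReal 0 1))) := by
  intro f
  set k := (volume K).toReal with hk
  have hkpos : 0 < k := by
    refine ENNReal.toReal_pos ?_ hKcomp.measure_lt_top.ne
    exact (Measure.measure_pos_of_nonempty_interior _ ⟨0, hKint⟩).ne'
  set B : ℝ → Set (EuclideanSpace ℝ (Fin d)) := fun T => (T ^ γ) • K with hBdef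
  have hBfin : ∀ T, volume (B T) < ⊤ := fun T => (hKcomp.smul (T ^ γ)).measure_lt_top
  have hBvol : ∀ T, 0 < T → (volume (B T)).toReal = T ^ (γ * d) * k := by
    intro T hT
    simp only [hBdef]
    rw [Measure.addHaar_smul, ENNReal.toReal_mul, ENNReal.toReal_ofReal (abs_nonneg _),
      finrank_euclideanSpace_fin, abs_of_nonneg (by positivity), Real.rpow_mul hT.le,
      Real.rpow_natCast]
  have hfin : ∀ T, IsFiniteMeasure (win (B T) T) := fun T => by
    have : IsFiniteMeasure ((volume : Measure (EuclideanSpace ℝ (Fin d))).restrict (B T)) :=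
      ⟨by simpa using hBfin T⟩
    unfold win; infer_instance
  have hGF := field_GF P Z C hZmeas hZgauss hC01 hCunit
  have hwin : ∀ T, 0 < T → (win (B T) T).real Set.univ = T ^ (1 + γ * d) * k := by
    intro T hT
    rw [measureReal_def, win, ← Set.univ_prod_univ, Measure.prod_prod, ENNReal.toReal_mul]
    simp only [Measure.restrict_apply_univ]
    rw [hBvol T hT, Real.volume_Ioc, sub_zero, ENNReal.toReal_ofReal hT.le, Real.rpow_add hT,
      Real.rpow_one]
    ring
  have hσ : ∀ T, 0 < T → σ1sq T =
      ∫ pq, C ‖pq.1.2 - pq.2.2‖ |pq.1.1 - pq.2.1| ∂((win (B T) T).prod (win (B T) T)) := by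
    intro T hT
    rw [cov_int C hC01 hCcont (B T) (hBfin T) T hT.le, hσ1sq T hT]
    have hv : (volume ((T ^ γ) • K)).toReal = T ^ (γ * d) * k := hBvol T hT
    rw [hv]
    have hTp : 0 < T ^ (γ * d) := Real.rpow_pos_of_pos hT _
    have h2 : T ^ (2 * γ * d) = (T ^ (γ * d)) ^ 2 := by
      rw [← Real.rpow_natCast, ← Real.rpow_mul hT.le]
      congr 1
      push_cast; ring
    rw [h2, ← intervalIntegral.integral_const_mul, ← intervalIntegral.integral_const_mul]
    refine intervalIntegral.integral_congr fun τ _ => ?_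
    simp only [hBdef]
    field_simp
  have hσnn : ∀ T, 0 < T → 0 ≤ σ1sq T := fun T hT => by
    rw [hσ T hT]; exact integral_nonneg fun pq => (hC01 _ _).1
  -- growth of the variance
  have hgrow : ∀ c : ℝ, ∀ᶠ T in atTop, c * T ^ (1 + γ * d) ≤ σ1sq T := by
    intro c
    filter_upwards [hLRD.eventually_ge_atTop (max c 0), eventually_ge_atTop 1] with T h1 hT1
    have hT : 0 < T := by linarith
    have hpos : 0 < T ^ (1 + δ₁) * T ^ (γ * d * (1 + δ₂)) :=
      mul_pos (Real.rpow_pos_of_pos hT _) (Real.rpow_pos_of_pos hT _)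
    rw [le_div_iff₀ hpos] at h1
    refine le_trans ?_ h1
    have h2 : T ^ (1 + γ * d) ≤ T ^ (1 + δ₁) * T ^ (γ * d * (1 + δ₂)) := by
      rw [← Real.rpow_add hT]
      refine Real.rpow_le_rpow_of_exponent_le hT1 ?_
      have : 0 ≤ γ * d := by positivity
      nlinarith [hδ₁.1, hδ₂.1, mul_nonneg this hδ₂.1.le]
    have h3 : 0 ≤ T ^ (1 + γ * d) := (Real.rpow_pos_of_pos hT _).le
    calc c * T ^ (1 + γ * d) ≤ max c 0 * T ^ (1 + γ * d) :=
          mul_le_mul_of_nonneg_right (le_max_left _ _) h3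
      _ ≤ _ := mul_le_mul_of_nonneg_left h2 (le_max_right _ _)
  have hσpos : ∀ᶠ T in atTop, 0 < σ1sq T := by
    filter_upwards [hgrow 1, eventually_gt_atTop 0] with T h1 hT
    have := Real.rpow_pos_of_pos hT (1 + γ * d)
    linarith
  have hsq : ∀ T, MemLp (fun ω => ∫ p, gg u (Z p.2 p.1 ω) ∂(win (B T) T)) 2 P ∧
      ∫ ω, (∫ p, gg u (Z p.2 p.1 ω) ∂(win (B T) T)) ^ 2 ∂P =
        ∫ pq, GG u (C ‖pq.1.2 - pq.2.2‖ |pq.1.1 - pq.2.1|)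
          ∂((win (B T) T).prod (win (B T) T)) := by
    intro T
    have h1 := hGF.sq_int (μ := win (B T) T) (gg_meas u) (gg_memLp u)
    simp only [hGF.covg] at h1
    exact h1
  -- reduction principle
  have hred : ∀ ε : ℝ, 0 < ε → ∀ᶠ T in atTop,
      ∫ ω, (∫ p, gg u (Z p.2 p.1 ω) ∂(win (B T) T)) ^ 2 ∂P ≤ ε * σ1sq T := by
    intro ε hε
    set A := ∫ x, gg u x ^ 2 ∂(gaussianReal 0 1) with hA
    have hA0 : 0 ≤ A := integral_nonneg fun x => sq_nonneg _
    obtain ⟨η, hη, hsmall⟩ := GG_small u (ε / 2) (by positivity)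
    obtain ⟨N, hN⟩ := hCdecay η hη
    set c := (volume.real (Metric.ball (0:ℝ) N) *
          volume.real (Metric.ball (0 : EuclideanSpace ℝ (Fin d)) N)) with hc
    filter_upwards [hgrow (A * c * k * (2 / ε)), eventually_gt_atTop 0] with T h1 hT
    rw [(hsq T).2]
    set near : Set ((ℝ × EuclideanSpace ℝ (Fin d)) × (ℝ × EuclideanSpace ℝ (Fin d))) :=
      {pq | ‖pq.1.2 - pq.2.2‖ < N ∧ |pq.1.1 - pq.2.1| < N} with hnear
    have hnm : MeasurableSet near := by
      apply MeasurableSet.inter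
      · exact (isOpen_lt (f := fun pq : (ℝ × EuclideanSpace ℝ (Fin d)) ×
          (ℝ × EuclideanSpace ℝ (Fin d)) => ‖pq.1.2 - pq.2.2‖)
            (by fun_prop) continuous_const).measurableSet
      · exact (isOpen_lt (f := fun pq : (ℝ × EuclideanSpace ℝ (Fin d)) ×
          (ℝ × EuclideanSpace ℝ (Fin d)) => |pq.1.1 - pq.2.1|)
            (by fun_prop) continuous_const).measurableSet
    have hpt : ∀ pq : (ℝ × EuclideanSpace ℝ (Fin d)) × (ℝ × EuclideanSpace ℝ (Fin d)),
        GG u (C ‖pq.1.2 - pq.2.2‖ |pq.1.1 - pq.2.1|)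
          ≤ ε / 2 * C ‖pq.1.2 - pq.2.2‖ |pq.1.1 - pq.2.1| + near.indicator (fun _ => A) pq := by
      intro pq
      have hC0 := (hC01 ‖pq.1.2 - pq.2.2‖ |pq.1.1 - pq.2.1|).1
      by_cases hm : pq ∈ near
      · rw [Set.indicator_of_mem hm]
        have h2 : GG u (C ‖pq.1.2 - pq.2.2‖ |pq.1.1 - pq.2.1|) ≤ A := by
          rw [← hGF.covg u pq.1 pq.2]
          refine le_trans ?_ (hGF.abs_pair (gg_memLp u) pq.1 pq.2)
          exact (le_abs_self _).trans (abs_integral_le_integral_abs)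
        have : 0 ≤ ε / 2 * C ‖pq.1.2 - pq.2.2‖ |pq.1.1 - pq.2.1| := by positivity
        linarith
      · rw [Set.indicator_of_notMem hm, add_zero]
        refine (le_abs_self _).trans (hsmall _ hC0 (hN _ _ (norm_nonneg _) (abs_nonneg _) ?_))
        by_contra hlt
        rw [not_le, max_lt_iff] at hlt
        exact hm hlt
    have hiG : Integrable (fun pq : (ℝ × EuclideanSpace ℝ (Fin d)) ×
        (ℝ × EuclideanSpace ℝ (Fin d)) => GG u (C ‖pq.1.2 - pq.2.2‖ |pq.1.1 - pq.2.1|))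
        ((win (B T) T).prod (win (B T) T)) := by
      have h3 := (hGF.int3 (μ := win (B T) T) (gg_meas u) (gg_memLp u)).integral_prod_left
      simp only [hGF.covg] at h3
      exact h3
    have hiC : Integrable (fun pq : (ℝ × EuclideanSpace ℝ (Fin d)) ×
        (ℝ × EuclideanSpace ℝ (Fin d)) => C ‖pq.1.2 - pq.2.2‖ |pq.1.1 - pq.2.1|)
        ((win (B T) T).prod (win (B T) T)) := by
      have hcc : Continuous (fun pq : (ℝ × EuclideanSpace ℝ (Fin d)) ×
        (ℝ × EuclideanSpace ℝ (Fin d)) => C ‖pq.1.2 - pq.2.2‖ |pq.1.1 - pq.2.1|) :=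
        hCcont.comp (f := fun pq : (ℝ × EuclideanSpace ℝ (Fin d)) ×
          (ℝ × EuclideanSpace ℝ (Fin d)) => (‖pq.1.2 - pq.2.2‖, |pq.1.1 - pq.2.1|)) (by fun_prop)
      refine Integrable.of_bound hcc.aestronglyMeasurable 1 (ae_of_all _ fun pq => ?_)
      rw [Real.norm_of_nonneg (hC01 _ _).1]; exact (hC01 _ _).2
    have hiN : Integrable (near.indicator (fun _ => A)) ((win (B T) T).prod (win (B T) T)) :=
      (integrable_const A).indicator hnm
    refine (integral_mono hiG ((hiC.const_mul _).add hiN) hpt).trans ?_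
    rw [integral_add' (hiC.const_mul _) hiN, integral_const_mul, ← hσ T hT,
      integral_indicator hnm, integral_const, measureReal_restrict_apply_univ, smul_eq_mul]
    have h4 := near_meas (B T) (hBfin T) T N
    rw [hwin T hT] at h4
    have h5 : ((win (B T) T).prod (win (B T) T)).real near * A ≤ ε / 2 * σ1sq T := by
      calc _ ≤ (c * (T ^ (1 + γ * d) * k)) * A := mul_le_mul_of_nonneg_right h4 hA0
        _ = ε / 2 * (A * c * k * (2 / ε) * T ^ (1 + γ * d)) := by field_simp
        _ ≤ _ := mul_le_mul_of_nonneg_left h1 (by positivity)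
    linarith
  have hφ := gphi_pos u
  -- the three families of random variables
  set X : ℝ → Ω → ℝ := fun T ω => (∫ p, Z p.2 p.1 ω ∂(win (B T) T)) / Real.sqrt (σ1sq T) with hX
  set Y : ℝ → Ω → ℝ := fun T ω =>
    ((∫ p, Set.indicator (Set.Ici u) (fun _ => (1:ℝ)) (Z p.2 p.1 ω) ∂(win (B T) T))
      - (1 - gPhi u) * k * T ^ (1 + γ * d)) / (gphi u * Real.sqrt (σ1sq T)) with hYdef
  set R : ℝ → Ω → ℝ := fun T ω =>
    (∫ p, gg u (Z p.2 p.1 ω) ∂(win (B T) T)) / (gphi u * Real.sqrt (σ1sq T)) with hR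
  have hLm : ∀ T, MemLp (fun ω => ∫ p, Z p.2 p.1 ω ∂(win (B T) T)) 2 P := fun T =>
    (hGF.sq_int (μ := win (B T) T) (g := fun x => x) measurable_id id_memLp).1
  have hIm : Measurable (Set.indicator (Set.Ici u) (fun _ : ℝ => (1:ℝ))) :=
    measurable_const.indicator measurableSet_Ici
  have hIL : MemLp (Set.indicator (Set.Ici u) (fun _ : ℝ => (1:ℝ))) 2 (gaussianReal 0 1) :=
    ind_memLp u _ (fun x => x) measurable_id 2
  have hIi : ∀ T ω, Integrable (fun p : ℝ × EuclideanSpace ℝ (Fin d) =>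
      Set.indicator (Set.Ici u) (fun _ => (1:ℝ)) (Z p.2 p.1 ω)) (win (B T) T) := by
    intro T ω
    have hmz : Measurable (fun p : ℝ × EuclideanSpace ℝ (Fin d) => Z p.2 p.1 ω) :=
      hGF.meas.comp (measurable_id.prodMk measurable_const)
    exact memLp_one_iff_integrable.1 (ind_memLp u (win (B T) T) _ hmz 1)
  have hmain := slutsky_final P X Y R
    (fun T => (hLm T).aestronglyMeasurable.aemeasurable.div_const _)
    (fun T => (((hGF.sq_int (μ := win (B T) T) hIm hIL).1.aestronglyMeasurable.aemeasurable).sub_const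
      _).div_const _)
    (fun T => by
      have := (hsq T).1.mul_const (gphi u * Real.sqrt (σ1sq T))⁻¹
      simpa only [hR, div_eq_mul_inv] using this)
    ?_ ?_ ?_ f
  · refine hmain.congr' ?_
    filter_upwards [eventually_gt_atTop 0] with T hT
    refine integral_congr_ae (ae_of_all _ fun ω => ?_)
    simp only [hYdef]
    rw [hM T hT ω, intervalIntegral.integral_of_le hT.le]
    have := integral_prod (μ := volume.restrict (Set.Ioc 0 T)) (ν := volume.restrict (B T)) _
      (hIi T ω)
    rw [← this]
    rfl
  · filter_upwards [hσpos, eventually_gt_atTop 0] with T h1 hT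
    have h2 := hGF.law_int (μ := win (B T) T)
    rw [← hσ T hT] at h2
    have h3 : X T = (fun x => x / Real.sqrt (σ1sq T)) ∘ fun ω => ∫ p, Z p.2 p.1 ω ∂(win (B T) T) :=
      rfl
    rw [h3, ← AEMeasurable.map_map_of_aemeasurable (by fun_prop)
      (hLm T).aestronglyMeasurable.aemeasurable, h2, gaussianReal_map_div_const]
    congr 1
    · simp
    · ext
      simp only [NNReal.coe_div, NNReal.coe_mk, NNReal.coe_one]
      rw [Real.coe_toNNReal _ h1.le, Real.sq_sqrt h1.le, div_self h1.ne']
  · filter_upwards [hσpos, eventually_gt_atTop 0] with T h1 hT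
    have hzi := (hGF.memLp_prod (μ := win (B T) T) (g := fun x => x) measurable_id id_memLp).integrable
      (by norm_num)
    filter_upwards [hzi.prod_left_ae] with ω hω
    have hs : 0 < Real.sqrt (σ1sq T) := Real.sqrt_pos.2 h1
    simp only [hR, hYdef, hX, gg]
    have hi1 : Integrable (fun p : ℝ × EuclideanSpace ℝ (Fin d) =>
      Set.indicator (Set.Ici u) (fun _ => (1:ℝ)) (Z p.2 p.1 ω) - (1 - gPhi u)) (win (B T) T) :=
      (hIi T ω).sub (integrable_const _)
    rw [integral_sub hi1 (hω.const_mul _), integral_sub (hIi T ω) (integrable_const _),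
      integral_const_mul, integral_const, hwin T hT, smul_eq_mul]
    field_simp
  · rw [Metric.tendsto_atTop']
    intro ε hε
    have h1 := (hred (ε / 2 * gphi u ^ 2) (by positivity)).and (hσpos)
    obtain ⟨T0, hT0⟩ := eventually_atTop.1 h1
    refine ⟨T0, fun T hT => ?_⟩
    obtain ⟨h2, h3⟩ := hT0 T hT.le
    simp only [hR, div_pow]
    rw [integral_div, mul_pow, Real.sq_sqrt h3.le, Real.dist_eq, sub_zero, abs_of_nonneg, div_lt_iff₀
      (by positivity)]
    · have : 0 < ε * (gphi u ^ 2 * σ1sq T) := by positivity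
      linarith
    · exact div_nonneg (integral_nonneg fun ω => sq_nonneg _) (by positivity)
end
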